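/- arXiv:1907.00234 — 7 statements merged into one kernel-verified Lean document; each statement's English description precedes it below -/
import Mathlib

section
/- Every finite tree that is not a path contains a vertex u with deg(u) ≥ 3 at which at least two pendant paths are attached. -/
/-- `w : Fin (q+1) → V` is a pendant path of length `q ≥ 1` attached at `u` in `G`:
the vertices `w 0 = u, w 1, …, w q` are distinct, consecutive ones are adjacent,
the internal vertices `w 1, …, w (q-1)` have degree 2 in `G`, and the endpoint
`w q` is a leaf of `G`. -/
def IsPendantPath {V : Type*} [Fintype V] [DecidableEq V] (G : SimpleGraph V)
    [DecidableRel G.Adj] (u : V) (q : ℕ) (w : Fin (q + 1) → V) : Prop :=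
  1 ≤ q ∧ Function.Injective w ∧ w 0 = u ∧
  (∀ i : Fin q, G.Adj (w i.castSucc) (w i.succ)) ∧
  (∀ i : Fin (q + 1), i ≠ 0 → i ≠ Fin.last q → G.degree (w i) = 2) ∧
  G.degree (w (Fin.last q)) = 1

namespace SimpleGraph

variable {V : Type*} {G : SimpleGraph V}

/-- In a tree rooted at `r`, the parent of a vertex is unique. -/
lemma IsTree.eq_of_adj_of_dist_add_one_eq (hT : G.IsTree) {r v a b : V} (ha : G.Adj a v)
    (hb : G.Adj b v) (hda : G.dist r a + 1 = G.dist r v) (hdb : G.dist r b + 1 = G.dist r v) :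
    a = b := by
  obtain ⟨p, hp⟩ := hT.connected.exists_walk_length_eq_dist r a
  obtain ⟨q, hq⟩ := hT.connected.exists_walk_length_eq_dist r b
  have hp' : (p.concat ha).IsPath :=
    Walk.isPath_of_length_eq_dist _ (by rw [Walk.length_concat]; omega)
  have hq' : (q.concat hb).IsPath :=
    Walk.isPath_of_length_eq_dist _ (by rw [Walk.length_concat]; omega)
  have h := congrArg Walk.penultimate ((hT.existsUnique_path r v).unique hp' hq')
  simpa using h

variable [Fintype V] [DecidableRel G.Adj]

/-- In a tree rooted at `r`, all but at most one neighbour of a vertex are its children. -/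
lemma IsTree.degree_le_card_children_add_one (hT : G.IsTree) (r u : V) :
    G.degree u ≤ {v ∈ G.neighborFinset u | G.dist r v = G.dist r u + 1}.card + 1 := by
  rw [← card_neighborFinset_eq_degree, ← Finset.card_filter_add_card_filter_not
    (s := G.neighborFinset u) (fun v => G.dist r v = G.dist r u + 1)]
  gcongr
  refine Finset.card_le_one.2 fun a ha b hb => ?_
  simp only [Finset.mem_filter, mem_neighborFinset] at ha hb
  have h₁ := hT.dist_eq_dist_add_one_of_adj r ha.1
  have h₂ := hT.dist_eq_dist_add_one_of_adj r hb.1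
  exact hT.eq_of_adj_of_dist_add_one_eq (r := r) ha.1.symm hb.1.symm (by omega) (by omega)

/-- If all vertices farther from the root `r` than `u` have degree at most `2`, then every edge
from `u` away from `r` starts a pendant path. -/
lemma IsTree.exists_descending_path (hT : G.IsTree) {r u v : V} (huv : G.Adj u v)
    (hd : G.dist r v = G.dist r u + 1)
    (hdeg : ∀ x, G.dist r u < G.dist r x → G.degree x ≤ 2) :
    ∃ (q : ℕ) (f : ℕ → V), 1 ≤ q ∧ f 0 = u ∧ f 1 = v ∧ (∀ i < q, G.Adj (f i) (f (i + 1))) ∧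
      (∀ i ≤ q, G.dist r (f i) = G.dist r u + i) ∧
      (∀ i, 0 < i → i < q → G.degree (f i) = 2) ∧ G.degree (f q) = 1 := by
  obtain ⟨n, hn⟩ : ∃ n, Finset.univ.sup (G.dist r) < G.dist r v + n :=
    ⟨Finset.univ.sup (G.dist r) + 1, by omega⟩
  induction n generalizing u v with
  | zero =>
    have := Finset.le_sup (f := G.dist r) (Finset.mem_univ v)
    omega
  | succ n ih =>
    have hpos : 0 < G.degree v := (G.degree_pos_iff_exists_adj v).2 ⟨u, huv.symm⟩
    have hle := hdeg v (by omega)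
    by_cases h1 : G.degree v = 1
    · refine ⟨1, fun i => if i = 0 then u else v, le_rfl, rfl, rfl, ?_, ?_, ?_, by simpa using h1⟩
      · intro i hi
        obtain rfl : i = 0 := by omega
        simpa using huv
      · intro i hi
        interval_cases i <;> simp [hd]
      · intro i _ _
        omega
    · have hc := hT.degree_le_card_children_add_one r v
      obtain ⟨c, hc⟩ := Finset.card_pos.1
        (show 0 < {c ∈ G.neighborFinset v | G.dist r c = G.dist r v + 1}.card by omega)
      simp only [Finset.mem_filter, mem_neighborFinset] at hc
      obtain ⟨q, f, hq, h0, -, hadj, hdist, h2, hlast⟩ :=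
        ih hc.1 hc.2 (fun x hx => hdeg x (by omega)) (by omega)
      refine ⟨q + 1, fun i => Nat.casesOn i u f, by omega, rfl, h0, ?_, ?_, ?_, hlast⟩
      · rintro (_ | i) hi
        · subst h0
          exact huv
        · exact hadj i (by omega)
      · rintro (_ | i) hi
        · rfl
        · have := hdist i (by omega)
          dsimp only
          omega
      · rintro (_ | _ | i) hi hi'
        · omega
        · subst h0
          change G.degree (f 0) = 2
          omega
        · exact h2 (i + 1) (by omega) (by omega)

end SimpleGraph

/-- Every finite tree that is not a path (i.e. has some vertex of degree larger
than 2) contains a vertex `u` of degree at least 3 at which at least two pendant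
paths are attached (meeting only in `u`). -/
theorem tree_not_path_has_vertex_with_two_pendant_paths {V : Type*} [Fintype V]
    [DecidableEq V] (G : SimpleGraph V) [DecidableRel G.Adj] (hT : G.IsTree)
    (hnp : ¬ ∀ v : V, G.degree v ≤ 2) :
    ∃ u : V, 3 ≤ G.degree u ∧
      ∃ (q₁ : ℕ) (w₁ : Fin (q₁ + 1) → V) (q₂ : ℕ) (w₂ : Fin (q₂ + 1) → V),
        IsPendantPath G u q₁ w₁ ∧ IsPendantPath G u q₂ w₂ ∧
        ∀ i j, w₁ i = w₂ j → w₁ i = u := by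
  push Not at hnp
  obtain ⟨r, hr⟩ := hnp
  obtain ⟨u, hu, hmax⟩ := Finset.exists_max_image {x : V | 2 < G.degree x} (G.dist r)
    ⟨r, by simpa using hr⟩
  simp only [Finset.mem_filter, Finset.mem_univ, true_and] at hu hmax
  have hdeg : ∀ x, G.dist r u < G.dist r x → G.degree x ≤ 2 := fun x hx => by
    by_contra! h
    exact (hmax x h).not_gt hx
  have hcard := hT.degree_le_card_children_add_one r u
  obtain ⟨a, ha, b, hb, hab⟩ := Finset.one_lt_card.1
    (show 1 < {v ∈ G.neighborFinset u | G.dist r v = G.dist r u + 1}.card by omega)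
  simp only [Finset.mem_filter, SimpleGraph.mem_neighborFinset] at ha hb
  obtain ⟨q, f, hq, hf0, hf1, hfadj, hfdist, hf2, hfl⟩ :=
    hT.exists_descending_path ha.1 ha.2 hdeg
  obtain ⟨p, g, hp, hg0, hg1, hgadj, hgdist, hg2, hgl⟩ :=
    hT.exists_descending_path hb.1 hb.2 hdeg
  have pendant : ∀ (q : ℕ) (f : ℕ → V), 1 ≤ q → f 0 = u →
      (∀ i < q, G.Adj (f i) (f (i + 1))) → (∀ i ≤ q, G.dist r (f i) = G.dist r u + i) →
      (∀ i, 0 < i → i < q → G.degree (f i) = 2) → G.degree (f q) = 1 →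
      IsPendantPath G u q (fun i => f i) := by
    intro q f hq h0 hadj hdist h2 hl
    refine ⟨hq, fun i j hij => ?_, h0, fun i => hadj i i.2, fun i hi hi' => ?_, hl⟩
    · have h := congrArg (G.dist r) hij
      simp only [hdist i i.is_le, hdist j j.is_le] at h
      exact Fin.ext (by omega)
    · exact h2 i (Fin.pos_iff_ne_zero.2 hi) (Fin.val_lt_last hi')
  have disjoint : ∀ i, i + 1 ≤ q → i + 1 ≤ p → f (i + 1) ≠ g (i + 1) := by
    intro i
    induction i with
    | zero => simpa [hf1, hg1] using fun _ _ => hab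
    | succ i ih =>
      intro hi hj h
      refine ih (by omega) (by omega) (hT.eq_of_adj_of_dist_add_one_eq (r := r)
        (hfadj (i + 1) (by omega)) (h ▸ hgadj (i + 1) (by omega)) ?_ ?_)
      · rw [hfdist _ (by omega), hfdist _ hi]
        omega
      · rw [h, hgdist _ (by omega), hgdist _ hj]
        omega
  refine ⟨u, hu, q, fun i => f i, p, fun i => g i, pendant q f hq hf0 hfadj hfdist hf2 hfl,
    pendant p g hp hg0 hgadj hgdist hg2 hgl, ?_⟩
  rintro ⟨i, hi⟩ ⟨j, hj⟩ hij
  simp only at hij ⊢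
  have h := congrArg (G.dist r) hij
  rw [hfdist i (by omega), hgdist j (by omega)] at h
  obtain rfl : i = j := by omega
  cases i with
  | zero => exact hf0
  | succ i => exact absurd hij (disjoint i (by omega) (by omega))
end

section
/- Let n ≥ 8 be an integer and let r be an integer with 0 ≤ r ≤ ⌊n/4⌋. Then b_1(r) = x_1 + r·(1 − 1/x_2) < 0. -/
/-- For an integer `n ≥ 8` and an integer `r` with `0 ≤ r ≤ ⌊n/4⌋`, one has
`b₁(r) = x₁ + r (1 - 1/x₂) < 0`. -/
theorem b1_neg (n : ℕ) (hn : 8 ≤ n) (r : ℕ) (hr : r ≤ n / 4) :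
    let x1 : ℝ := -1 + 2 / n
    let x2 : ℝ := 2 / n - 1 / x1
    x1 + (r : ℝ) * (1 - 1 / x2) < 0 := by
  intro x1 x2
  have hn' : (8 : ℝ) ≤ n := by exact_mod_cast hn
  have hn0 : (0 : ℝ) < n := by linarith
  have hr' : (r : ℝ) * 4 ≤ n := by
    have h : r * 4 ≤ n := by omega
    exact_mod_cast h
  obtain ⟨t, ht⟩ : ∃ t : ℝ, t = 2 / n := ⟨_, rfl⟩
  have ht0 : 0 < t := by rw [ht]; positivity
  have ht4 : t ≤ 1 / 4 := by rw [ht, div_le_div_iff₀ hn0 (by norm_num)]; linarith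
  have htn : t * n = 2 := by rw [ht]; field_simp
  have hrt : (r : ℝ) * t ≤ 1 / 2 := by nlinarith
  have hx1 : x1 = -(1 - t) := by simp only [x1, ← ht]; ring
  have hd : 0 < 1 + t - t ^ 2 := by nlinarith
  have h1t : 1 - t ≠ 0 := by linarith
  have hx2 : x2 = (1 + t - t ^ 2) / (1 - t) := by
    simp only [x2, hx1, ← ht]
    field_simp
    ring
  have hstep : 1 - 1 / x2 = t * (2 - t) / (1 + t - t ^ 2) := by
    rw [hx2, one_div_div]
    field_simp
    ring
  have hbound : r * (t * (2 - t)) < (1 - t) * (1 + t - t ^ 2) := by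
    have h : r * t * (2 - t) ≤ 1 / 2 * (2 - t) :=
      mul_le_mul_of_nonneg_right hrt (by linarith)
    have hpos : 0 < t * (1 / 2 - 2 * t + t ^ 2) := mul_pos ht0 (by nlinarith)
    linarith
  have hlt : r * (1 - 1 / x2) < 1 - t := by
    rwa [hstep, ← mul_div_assoc, div_lt_iff₀ hd]
  linarith
end

section
/- Let n ≥ 8 be an integer and let r be an integer with 0 ≤ r ≤ ⌊n/4⌋ − 1. Then b_1(r) + 1/(2/n − 1/b_1(r)) ≥ x_1 + 1/(2/n − 1/x_1), with equality if and only if r = 0. -/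
/-- On the negative reals `b ↦ b + 1 / (e - 1 / b)` is strictly increasing when `e > 0`. -/
lemma strictMonoOn_add_one_div_sub_one_div {e : ℝ} (he : 0 < e) :
    StrictMonoOn (fun b : ℝ => b + 1 / (e - 1 / b)) (Set.Iio 0) := by
  intro a ha b hb hab
  rw [Set.mem_Iio] at ha hb
  have key : ∀ c : ℝ, c < 0 → 1 / (e - 1 / c) = -(c / (1 - e * c)) := by
    intro c hc
    have hc0 : c ≠ 0 := hc.ne
    have h2 : e - 1 / c = -((1 - e * c) / c) := by
      field_simp
      ring
    rw [h2, one_div, inv_neg, inv_div]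
  have ha1 : 1 < 1 - e * a := by nlinarith
  have hb1 : 1 < 1 - e * b := by nlinarith
  have hprod : 1 < (1 - e * a) * (1 - e * b) := by nlinarith
  have ha0 : 1 - e * a ≠ 0 := by linarith
  have hb0 : 1 - e * b ≠ 0 := by linarith
  have hdiff : b / (1 - e * b) - a / (1 - e * a)
      = (b - a) / ((1 - e * a) * (1 - e * b)) := by
    rw [div_sub_div _ _ hb0 ha0]
    congr 1 <;> ring
  have hlt : (b - a) / ((1 - e * a) * (1 - e * b)) < b - a :=
    div_lt_self (sub_pos.mpr hab) hprod
  simp only [key a ha, key b hb]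
  linarith

/-- For an integer `n ≥ 8` and an integer `r` with `0 ≤ r ≤ ⌊n/4⌋ - 1`, one has
`b₁(r) + 1/(2/n - 1/b₁(r)) ≥ x₁ + 1/(2/n - 1/x₁)`, with equality iff `r = 0`. -/
theorem starUp_key_inequality (n : ℕ) (hn : 8 ≤ n) (r : ℕ) (hr : r ≤ n / 4 - 1) :
    let x1 : ℝ := -1 + 2 / n
    let x2 : ℝ := 2 / n - 1 / x1
    let b1 : ℝ := x1 + (r : ℝ) * (1 - 1 / x2)
    x1 + 1 / (2 / n - 1 / x1) ≤ b1 + 1 / (2 / n - 1 / b1) ∧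
    (b1 + 1 / (2 / n - 1 / b1) = x1 + 1 / (2 / n - 1 / x1) ↔ r = 0) := by
  intro x1 x2 b1
  have hn' : (8 : ℝ) ≤ n := by exact_mod_cast hn
  have hr' : 4 * ((r : ℝ) + 1) ≤ n := by
    have : 4 * (r + 1) ≤ n := by omega
    exact_mod_cast this
  have hr0 : (0 : ℝ) ≤ r := Nat.cast_nonneg r
  obtain ⟨e, he⟩ : ∃ e : ℝ, e = 2 / n := ⟨_, rfl⟩
  have he0 : 0 < e := by rw [he]; positivity
  have hne : e * n = 2 := by rw [he]; field_simp
  have he1 : e ≤ 1 / 4 := by nlinarith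
  have her : e * r ≤ 1 / 2 - e := by nlinarith
  have hx1 : x1 = -1 + e := by rw [he]
  have hx1neg : x1 < 0 := by linarith
  have hden : 0 < 1 + e - e ^ 2 := by nlinarith
  have hx2 : 1 - 1 / x2 = e * (2 - e) / (1 + e - e ^ 2) := by
    have h1 : 1 - e ≠ 0 := by linarith
    have h2 : x2 = (1 + e - e ^ 2) / (1 - e) := by
      change 2 / (n : ℝ) - 1 / x1 = _
      rw [← he, hx1, show -1 + e = -(1 - e) by ring]
      field_simp
      ring
    rw [h2, one_div_div]
    field_simp
    ring
  have hstep : 0 < 1 - 1 / x2 := by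
    rw [hx2]
    exact div_pos (mul_pos he0 (by linarith)) hden
  have hb1neg : b1 < 0 := by
    have h : (r : ℝ) * (1 - 1 / x2) < 1 - e := by
      rw [hx2, ← mul_div_assoc, div_lt_iff₀ hden]
      nlinarith [mul_le_mul_of_nonneg_right her (show (0 : ℝ) ≤ 2 - e by linarith),
        pow_pos he0 3]
    change x1 + (r : ℝ) * (1 - 1 / x2) < 0
    linarith
  have hmono := strictMonoOn_add_one_div_sub_one_div he0
  rw [he] at hmono
  have hle : x1 ≤ b1 := le_add_of_nonneg_right (mul_nonneg hr0 hstep.le)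
  refine ⟨hmono.monotoneOn hx1neg hb1neg hle, fun h => ?_, fun h => ?_⟩
  · have hb : b1 = x1 := hmono.injOn hb1neg hx1neg h
    have hmul : (r : ℝ) * (1 - 1 / x2) = 0 := add_eq_left.mp hb
    exact_mod_cast (mul_eq_zero.mp hmul).resolve_right hstep.ne'
  · have hb : b1 = x1 := by simp [b1, h]
    rw [hb]
end

section
/- Let n ≥ 8 be an integer and let r be an integer with 0 ≤ r ≤ ⌊n/4⌋ − 1. Then (1 − 1/x_2)·(−1 + 1/(b_1(r)·b_1(r+1))) > 0; equivalently, 1/b_1(r) − 1/b_1(r+1) > 1 − 1/x_2. -/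
/-- The gap `1 - 1/x₂`, as a function of `e = 2/n`, is positive, and `1/(2e)` steps of it starting
from `x₁ = -1 + e` stay below `0`. -/
lemma gap_pos_and_lt {e : ℝ} (he : 0 < e) (he4 : e ≤ 1 / 4) :
    0 < 1 - 1 / (e - 1 / (-1 + e)) ∧
      1 - 1 / (e - 1 / (-1 + e)) < 2 * e * (1 - e) := by
  have hD : 0 < 1 + e - e ^ 2 := by nlinarith
  have hx : (-1 + e) ≠ 0 := by linarith
  have hx2 : e - 1 / (-1 + e) = (1 + e - e ^ 2) / (1 - e) := by
    have : 1 - e ≠ 0 := by linarith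
    field_simp
    ring
  have hd : 1 - 1 / (e - 1 / (-1 + e)) = e * (2 - e) / (1 + e - e ^ 2) := by
    rw [hx2, one_div_div]
    field_simp
    ring
  rw [hd]
  refine ⟨div_pos (mul_pos he (by linarith)) hD, ?_⟩
  rw [div_lt_iff₀ hD]
  have h : 2 - e < 2 * (1 - e) * (1 + e - e ^ 2) := by
    nlinarith [mul_pos he (show 0 < 1 - 4 * e + 2 * e ^ 2 by nlinarith [sq_pos_of_pos he])]
  nlinarith [mul_lt_mul_of_pos_left h he]

/-- For an integer `n ≥ 8` and an integer `r` with `0 ≤ r ≤ ⌊n/4⌋ - 1`, one has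
`(1 - 1/x₂)(-1 + 1/(b₁(r) b₁(r+1))) > 0`; equivalently
`1/b₁(r) - 1/b₁(r+1) > 1 - 1/x₂`. -/
theorem starDown_key_inequality (n : ℕ) (hn : 8 ≤ n) (r : ℕ) (hr : r ≤ n / 4 - 1) :
    let x1 : ℝ := -1 + 2 / n
    let x2 : ℝ := 2 / n - 1 / x1
    let b1 : ℝ → ℝ := fun s => x1 + s * (1 - 1 / x2)
    0 < (1 - 1 / x2) * (-1 + 1 / (b1 r * b1 (r + 1))) ∧
    1 - 1 / x2 < 1 / b1 r - 1 / b1 (r + 1) := by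
  intro x1 x2 b1
  have hn' : (8 : ℝ) ≤ n := by exact_mod_cast hn
  have he : (0 : ℝ) < 2 / n := by positivity
  have he4 : (2 : ℝ) / n ≤ 1 / 4 := by
    rw [div_le_iff₀ (by linarith)]
    linarith
  have hrn : 4 * ((r : ℝ) + 1) ≤ n := by
    have : 4 * (r + 1) ≤ n := by omega
    exact_mod_cast this
  have hre : 2 * ((r : ℝ) + 1) * (2 / n) ≤ 1 := by
    rw [← mul_div_assoc, div_le_one (by linarith)]
    linarith
  obtain ⟨hd, hlt⟩ : 0 < 1 - 1 / x2 ∧ 1 - 1 / x2 < 2 * (2 / (n : ℝ)) * (1 - 2 / n) :=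
    gap_pos_and_lt he he4
  have hr0 : (0 : ℝ) ≤ r := r.cast_nonneg
  have hstep : b1 (r + 1) = b1 r + (1 - 1 / x2) := by
    simp only [b1]
    ring
  have hlow : -1 < b1 r := by
    have := mul_nonneg hr0 hd.le
    simp only [b1, x1]
    linarith
  have hneg : b1 (r + 1) < 0 := by
    have h₁ := mul_lt_mul_of_pos_left hlt (show (0 : ℝ) < r + 1 by linarith)
    have h₂ := mul_le_mul_of_nonneg_right hre (show (0 : ℝ) ≤ 1 - 2 / n by linarith)
    simp only [b1, x1]
    linarith
  have hneg' : b1 r < 0 := by linarith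
  have hprod : 0 < b1 r * b1 (r + 1) := mul_pos_of_neg_of_neg hneg' hneg
  have hprod1 : b1 r * b1 (r + 1) < 1 := by nlinarith
  have hkey : 0 < (1 - 1 / x2) * (-1 + 1 / (b1 r * b1 (r + 1))) := by
    have := (one_lt_div hprod).2 hprod1
    exact mul_pos hd (by linarith)
  refine ⟨hkey, ?_⟩
  have hdiff : 1 / b1 r - 1 / b1 (r + 1) = (1 - 1 / x2) * (1 / (b1 r * b1 (r + 1))) := by
    rw [div_sub_div _ _ hneg'.ne hneg.ne, mul_one_div]
    congr 1
    linarith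
  rw [hdiff]
  linarith
end

section
/- (Star-up transform is proper.) Let T be a tree on n ≥ 8 vertices, let u be a vertex of T that is not a leaf, and suppose T contains a path u = w_0, w_1, …, w_q with q ≥ 2 such that w_1, …, w_{q−1} all have degree 2 in T, and w_q has degree r + 1 in T with exactly r pendant P_2's attached at w_q, where 0 ≤ r ≤ ⌊n/4⌋ − 1. Let T′ be the tree on n vertices obtained from T by deleting the two path vertices w_{q−1} and w_{q−2}'s successor structure—that is, by shortening the path from u to the sun vertex by two edges (so it becomes u = w_0, …, w_{q−2}, with w_{q−2} now carrying the sun) and attaching one additional pendant path of length 2 at that end vertex—leaving the rest of T unchanged. Then the number of Laplacian eigenvalues of T′ that are ≥ 2 − 2/n is at least the number of Laplacian eigenvalues of T that are ≥ 2 − 2/n. -/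
/-- The Laplacian matrix of a finite simple graph over `ℝ` is Hermitian (real symmetric). -/
noncomputable def lapHerm {V : Type*} [Fintype V] [DecidableEq V]
    (G : SimpleGraph V) [DecidableRel G.Adj] : (G.lapMatrix ℝ).IsHermitian :=
  (SimpleGraph.posSemidef_lapMatrix ℝ G).isHermitian

/-- A real symmetric matrix becomes diagonal in suitable orthonormal coordinates. -/
theorem exists_diagonalizing_equiv {V : Type*} [Fintype V] [DecidableEq V]
    {A : Matrix V V ℝ} (hA : A.IsHermitian) :
    ∃ C : (V → ℝ) ≃ₗ[ℝ] (V → ℝ),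
      (∀ x, x ⬝ᵥ A.mulVec x = ∑ i, hA.eigenvalues i * (C x i) ^ 2) ∧
      ∀ x, x ⬝ᵥ x = ∑ i, (C x i) ^ 2 := by
  set U : Matrix V V ℝ := (hA.eigenvectorUnitary : Matrix V V ℝ)
  have h1 : star U * U = 1 := Unitary.coe_star_mul_self hA.eigenvectorUnitary
  have h2 : U * star U = 1 := Unitary.coe_mul_star_self hA.eigenvectorUnitary
  have hvec : ∀ x : V → ℝ, Matrix.vecMul x U = (star U).mulVec x := fun x => by
    rw [Matrix.star_eq_conjTranspose, Matrix.conjTranspose_eq_transpose_of_trivial,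
      Matrix.mulVec_transpose]
  refine ⟨LinearEquiv.ofLinearMap (Matrix.toLin' (star U)) (Matrix.toLin' U)
    (by rw [← Matrix.toLin'_mul, h1, Matrix.toLin'_one])
    (by rw [← Matrix.toLin'_mul, h2, Matrix.toLin'_one]), fun x => ?_, fun x => ?_⟩
  · have hspec : A = U * Matrix.diagonal hA.eigenvalues * star U := by
      simpa [Unitary.conjStarAlgAut_apply] using hA.spectral_theorem
    conv_lhs => rw [hspec, ← Matrix.mulVec_mulVec, ← Matrix.mulVec_mulVec,
      Matrix.dotProduct_mulVec, hvec]
    simp only [dotProduct, Matrix.mulVec_diagonal]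
    exact Finset.sum_congr rfl fun i _ => by
      simp only [LinearEquiv.coe_ofLinearMap, Matrix.toLin'_apply]; ring
  · have : x ⬝ᵥ (U * star U).mulVec x = ∑ i, ((star U).mulVec x i) ^ 2 := by
      rw [← Matrix.mulVec_mulVec, Matrix.dotProduct_mulVec, hvec]
      simp [dotProduct, sq]
    rw [h2, Matrix.one_mulVec] at this
    simpa using this

/-- If `φ` is injective and the quadratic form of `A - α` at `x` is at most that of `B - α` at `φ x`,
then `B` has at least as many eigenvalues `≥ α` as `A`. -/
theorem card_eigenvalues_le_of_injective {V : Type*} [Fintype V] [DecidableEq V]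
    {A B : Matrix V V ℝ} (hA : A.IsHermitian) (hB : B.IsHermitian) (α : ℝ)
    (φ : (V → ℝ) →ₗ[ℝ] (V → ℝ)) (hφ : Function.Injective φ)
    (h : ∀ x, x ⬝ᵥ A.mulVec x - α * (x ⬝ᵥ x) ≤ φ x ⬝ᵥ B.mulVec (φ x) - α * (φ x ⬝ᵥ φ x)) :
    Nat.card {i // α ≤ hA.eigenvalues i} ≤ Nat.card {i // α ≤ hB.eigenvalues i} := by
  obtain ⟨C, hC, hC'⟩ := exists_diagonalizing_equiv hA
  obtain ⟨D, hD, hD'⟩ := exists_diagonalizing_equiv hB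
  let ι : ({i // α ≤ hA.eigenvalues i} → ℝ) →ₗ[ℝ] (V → ℝ) :=
    Function.ExtendByZero.linearMap ℝ Subtype.val
  let Ψ : ({i // α ≤ hA.eigenvalues i} → ℝ) →ₗ[ℝ] ({i // α ≤ hB.eigenvalues i} → ℝ) :=
    LinearMap.funLeft ℝ ℝ Subtype.val ∘ₗ D.toLinearMap ∘ₗ φ ∘ₗ C.symm.toLinearMap ∘ₗ ι
  have hΨ : Function.Injective Ψ := by
    rw [← LinearMap.ker_eq_bot, LinearMap.ker_eq_bot']
    intro c hc
    have h1 := h (C.symm (ι c))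
    set y := φ (C.symm (ι c)) with hy
    have hpos : 0 ≤ C.symm (ι c) ⬝ᵥ A.mulVec (C.symm (ι c))
        - α * (C.symm (ι c) ⬝ᵥ C.symm (ι c)) := by
      rw [hC, hC', Finset.mul_sum, ← Finset.sum_sub_distrib]
      refine Finset.sum_nonneg fun i _ => ?_
      rw [LinearEquiv.apply_symm_apply]
      by_cases hi : α ≤ hA.eigenvalues i
      · nlinarith [sq_nonneg (ι c i)]
      · have : ι c i = 0 := Function.extend_apply' _ _ _ (by rintro ⟨⟨j, hj⟩, rfl⟩; exact hi hj)
        simp [this]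
    have hzero : ∀ i, α ≤ hB.eigenvalues i → D y i = 0 := fun i hi => congrFun hc ⟨i, hi⟩
    have hDy : D y = 0 := by
      have hneg := hpos.trans h1
      rw [hD, hD', Finset.mul_sum, ← Finset.sum_sub_distrib] at hneg
      have hle : ∀ i ∈ Finset.univ,
          hB.eigenvalues i * (D y i) ^ 2 - α * (D y i) ^ 2 ≤ 0 := by
        intro i _
        by_cases hi : α ≤ hB.eigenvalues i
        · simp [hzero i hi]
        · nlinarith [sq_nonneg (D y i)]
      have hall := (Finset.sum_eq_zero_iff_of_nonpos hle).1
        (le_antisymm (Finset.sum_nonpos hle) hneg)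
      funext i
      by_cases hi : α ≤ hB.eigenvalues i
      · exact hzero i hi
      · have := hall i (Finset.mem_univ i)
        rw [← sub_mul] at this
        rcases mul_eq_zero.1 this with h0 | h0
        · exact absurd (by linarith) hi
        · exact pow_eq_zero_iff two_ne_zero |>.1 h0
    have hy0 : y = 0 := by simpa using hDy
    have hι : ι c = 0 := by
      have : C.symm (ι c) = 0 := hφ (by rw [← hy, hy0, map_zero])
      simpa using this
    funext i
    have := congrFun hι i
    rwa [show ι c i = c i from Subtype.val_injective.extend_apply _ _ _] at this
  simpa [Nat.card_eq_fintype_card] using LinearMap.finrank_le_finrank_of_injective hΨ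

/-- Splitting a sum over the ordered edges of a graph into the edges avoiding `Set.range s` and the
remaining edges, when these are exactly the edges joining `s k` to its parent `par k`. -/
theorem sum_adj_eq_sum_rest_add {V K : Type*} [Fintype V] [DecidableEq V] [Fintype K]
    (G : SimpleGraph V) [DecidableRel G.Adj] (s par : K → V) (hs : Function.Injective s)
    (hedge : ∀ k x, G.Adj (s k) x ↔ x = par k ∨ ∃ l, x = s l ∧ s k = par l)
    (hanti : ∀ k l, s k = par l → par k ≠ s l)
    (f : V → V → ℝ) (hf : ∀ i j, f i j = f j i) :
    (∑ i, ∑ j, if G.Adj i j then f i j else 0) =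
      (∑ i, ∑ j, open Classical in
        if G.Adj i j ∧ i ∉ Set.range s ∧ j ∉ Set.range s then f i j else 0)
      + 2 * ∑ k, f (s k) (par k) := by
  classical
  have hpar : ∀ k x, G.Adj x (s k) ↔ x = par k ∨ ∃ l, x = s l ∧ s k = par l :=
    fun k x => by rw [G.adj_comm, hedge]
  have hpt : ∀ i j, (if G.Adj i j then f i j else 0) =
      (if G.Adj i j ∧ i ∉ Set.range s ∧ j ∉ Set.range s then f i j else 0)
      + ((∑ k, if i = s k then if j = par k then f i j else 0 else 0)
        + ∑ k, if j = s k then if i = par k then f i j else 0 else 0) := by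
    have hfst : ∀ k, (∑ l, if s k = s l then if par k = par l then f (s k) (par k) else 0 else 0)
        = f (s k) (par k) := fun k => by simp [hs.eq_iff]
    have hsnd : ∀ k, (∑ l, if par k = s l then if s k = par l then f (s k) (par k) else 0 else 0)
        = 0 := fun k => Finset.sum_eq_zero fun l _ => by
      split_ifs with h1 h2
      · exact absurd h1 (hanti k l h2)
      all_goals rfl
    intro i j
    by_cases hij : G.Adj i j
    · by_cases hS : i ∉ Set.range s ∧ j ∉ Set.range s
      · have hi : ∀ k, i ≠ s k := fun k hk => hS.1 ⟨k, hk.symm⟩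
        have hj : ∀ k, j ≠ s k := fun k hk => hS.2 ⟨k, hk.symm⟩
        simp [hij, hi, hj, fun k => (hi k).symm, fun k => (hj k).symm]
      · have hk : (∃ k, i = s k ∧ j = par k) ∨ ∃ k, j = s k ∧ i = par k := by
          by_cases hi : i ∈ Set.range s
          · obtain ⟨k, rfl⟩ := hi
            rcases (hedge k j).1 hij with h | ⟨l, h, h'⟩
            · exact Or.inl ⟨k, rfl, h⟩
            · exact Or.inr ⟨l, h, h'⟩
          · have hj : j ∈ Set.range s := by tauto
            obtain ⟨k, rfl⟩ := hj
            rcases (hpar k i).1 hij with h | ⟨l, h, h'⟩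
            · exact Or.inr ⟨k, rfl, h⟩
            · exact Or.inl ⟨l, h, h'⟩
        rw [if_pos hij, if_neg (fun h => hS h.2)]
        rcases hk with ⟨k, rfl, rfl⟩ | ⟨k, rfl, rfl⟩
        · rw [hfst, hsnd]; ring
        · rw [hf (par k), add_comm (Finset.sum _ _), hfst, hsnd]; ring
    · have h1 : ∀ k, i = s k → j ≠ par k := by
        rintro k rfl rfl; exact hij ((hedge k _).2 (Or.inl rfl))
      have h2 : ∀ k, j = s k → i ≠ par k := by
        rintro k rfl rfl; exact hij ((hpar k _).2 (Or.inl rfl))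
      have e1 : (∑ k, if i = s k then if j = par k then f i j else 0 else 0) = 0 :=
        Finset.sum_eq_zero fun k _ => by
          split_ifs with ha hb
          · exact absurd hb (h1 k ha)
          all_goals rfl
      have e2 : (∑ k, if j = s k then if i = par k then f i j else 0 else 0) = 0 :=
        Finset.sum_eq_zero fun k _ => by
          split_ifs with ha hb
          · exact absurd hb (h2 k ha)
          all_goals rfl
      simp [hij, e1, e2]
  simp_rw [hpt, Finset.sum_add_distrib]
  congr 1
  have e1 : (∑ i, ∑ j, ∑ k, if i = s k then if j = par k then f i j else 0 else 0)
      = ∑ k, f (s k) (par k) := by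
    simp_rw [Finset.sum_comm (t := (Finset.univ : Finset K)) (s := (Finset.univ : Finset V))]
    refine Finset.sum_congr rfl fun k _ => ?_
    rw [Finset.sum_eq_single (s k) (by intro b _ hb; simp [hb]) (by simp)]
    simp
  have e2 : (∑ i, ∑ j, ∑ k, if j = s k then if i = par k then f i j else 0 else 0)
      = ∑ k, f (s k) (par k) := by
    rw [Finset.sum_comm, ← e1]
    simp_rw [hf]
  rw [e1, e2]; ring

/-- Adding a multiple of a change in the attachment value `c` to the coordinates of a pendant `P₂`
changes its contribution only by a multiple of the squares of the attachment values. -/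
theorem pendant_form_shift {ε : ℝ} (h0 : 0 < ε) (h1 : ε < 1) (v z a b : ℝ) :
    (a + (z - v) * (ε + 1 / (1 - ε))⁻¹ - z) ^ 2
      + (b - (z - v) * (ε + 1 / (1 - ε))⁻¹ / (1 - ε)
          - (a + (z - v) * (ε + 1 / (1 - ε))⁻¹)) ^ 2
      - (2 - ε) * ((a + (z - v) * (ε + 1 / (1 - ε))⁻¹) ^ 2
          + (b - (z - v) * (ε + 1 / (1 - ε))⁻¹ / (1 - ε)) ^ 2)
      = (a - v) ^ 2 + (b - a) ^ 2 - (2 - ε) * (a ^ 2 + b ^ 2)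
        + (1 - (ε + 1 / (1 - ε))⁻¹) * (z ^ 2 - v ^ 2) := by
  have ht : 0 < 1 - ε := by linarith
  have hx : 0 < ε * (1 - ε) + 1 := by positivity
  have e : ε + 1 / (1 - ε) = (ε * (1 - ε) + 1) / (1 - ε) := by field_simp
  rw [e, inv_div]
  field_simp
  ring

/-- Comparison of the forms of two paths `z, y, v` whose ends carry the weights `t - τ` at `v` and
at `z` respectively, after a triangular change of the variables `y, v`. -/
theorem path_form_le {ε t τ : ℝ} (h0 : 0 < ε) (ht : t = 1 - ε) (hτ : 0 < τ) (hle : τ ≤ t)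
    (z y v : ℝ) :
    (y - z) ^ 2 + (v - y) ^ 2 - (2 - ε) * (y ^ 2 + v ^ 2) + (t - τ) * v ^ 2 ≤
      ((ε + 1 / τ) / (ε + 1 / t) * y - z) ^ 2
      + (τ / t * v + (1 / t - (ε + 1 / τ) / (ε + 1 / t) / t) * y
          - (ε + 1 / τ) / (ε + 1 / t) * y) ^ 2
      - (2 - ε) * (((ε + 1 / τ) / (ε + 1 / t) * y) ^ 2
          + (τ / t * v + (1 / t - (ε + 1 / τ) / (ε + 1 / t) / t) * y) ^ 2)
      + (t - τ) * z ^ 2 := by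
  have htpos : 0 < t := hτ.trans_le hle
  have hinv : 1 / t ≤ 1 / τ := one_div_le_one_div_of_le hτ hle
  set p := ε + 1 / τ with hp
  set p' := ε + 1 / t with hp'
  have hp0 : 0 < p' := by positivity
  have hpp : p' ≤ p := by linarith
  have hp1 : 0 < p := by linarith
  have hα : ε = 1 - t := by linarith
  have lhs : (y - z) ^ 2 + (v - y) ^ 2 - (2 - ε) * (y ^ 2 + v ^ 2) + (t - τ) * v ^ 2
      = -τ * (v + y / τ) ^ 2 + p * (y - z / p) ^ 2 + (1 - 1 / p) * z ^ 2 := by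
    have : p * (y - z / p) ^ 2 = p * y ^ 2 - 2 * z * y + z ^ 2 / p := by field_simp; ring
    rw [this, hp, ht]; field_simp; ring
  have rhs : ∀ Y W : ℝ, (Y - z) ^ 2 + (W - Y) ^ 2 - (2 - ε) * (Y ^ 2 + W ^ 2)
      = -t * (W + Y / t) ^ 2 + p' * (Y - z / p') ^ 2 + (1 - 1 / p') * z ^ 2 := by
    intro Y W
    have : p' * (Y - z / p') ^ 2 = p' * Y ^ 2 - 2 * z * Y + z ^ 2 / p' := by field_simp; ring
    rw [this, hp', show (2 - ε) = 1 + t by linarith]; field_simp; rw [hα]; ring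
  rw [lhs, rhs]
  have e1 : τ / t * v + (1 / t - p / p' / t) * y + p / p' * y / t = τ / t * (v + y / τ) := by
    field_simp; ring
  have e2 : p / p' * y - z / p' = p / p' * (y - z / p) := by field_simp
  rw [e1, e2]
  have i1 : t * (τ / t * (v + y / τ)) ^ 2 ≤ τ * (v + y / τ) ^ 2 := by
    have : t * (τ / t * (v + y / τ)) ^ 2 = (τ / t) * (τ * (v + y / τ) ^ 2) := by field_simp
    rw [this]
    exact mul_le_of_le_one_left (by positivity) ((div_le_one htpos).2 hle)
  have i2 : p * (y - z / p) ^ 2 ≤ p' * (p / p' * (y - z / p)) ^ 2 := by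
    have : p' * (p / p' * (y - z / p)) ^ 2 = (p / p') * (p * (y - z / p) ^ 2) := by field_simp
    rw [this]
    exact le_mul_of_one_le_left (by positivity) ((one_le_div hp0).2 hpp)
  have i3 : 1 / p' - 1 / p ≤ t - τ := by
    have a1 : 1 / p' = t / (1 + ε * t) := by rw [hp']; field_simp; ring
    have a2 : 1 / p = τ / (1 + ε * τ) := by rw [hp]; field_simp; ring
    rw [a1, a2, div_sub_div _ _ (by positivity) (by positivity), div_le_iff₀ (by positivity)]
    have : t * (1 + ε * τ) - (1 + ε * t) * τ = t - τ := by ring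
    rw [this]
    refine le_mul_of_one_le_right (by linarith) ?_
    have : 0 < ε * t := by positivity
    have : 0 < ε * τ := by positivity
    nlinarith
  nlinarith [mul_le_mul_of_nonneg_right i3 (sq_nonneg z)]

theorem lapMatrix_quadratic_form {V : Type*} [Fintype V] [DecidableEq V]
    (G : SimpleGraph V) [DecidableRel G.Adj] (x : V → ℝ) :
    x ⬝ᵥ (G.lapMatrix ℝ).mulVec x = (∑ i, ∑ j, if G.Adj i j then (x i - x j) ^ 2 else 0) / 2 := by
  rw [← SimpleGraph.lapMatrix_toLinearMap₂', Matrix.toLinearMap₂'_apply']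

/-- If two graphs agree off `Set.range s` and two functions agree off `Set.range s`, then their
shifted Laplacian forms can be compared through the edges touching `Set.range s`. -/
theorem shifted_form_le_of_rest_eq {V K : Type*} [Fintype V] [DecidableEq V] [Fintype K]
    (G G' : SimpleGraph V) [DecidableRel G.Adj] [DecidableRel G'.Adj] (s par par' : K → V)
    (hs : Function.Injective s)
    (hedge : ∀ k x, G.Adj (s k) x ↔ x = par k ∨ ∃ l, x = s l ∧ s k = par l)
    (hanti : ∀ k l, s k = par l → par k ≠ s l)
    (hedge' : ∀ k x, G'.Adj (s k) x ↔ x = par' k ∨ ∃ l, x = s l ∧ s k = par' l)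
    (hanti' : ∀ k l, s k = par' l → par' k ≠ s l)
    (hrest : ∀ i j, i ∉ Set.range s → j ∉ Set.range s → (G.Adj i j ↔ G'.Adj i j))
    (x x' : V → ℝ) (hx : ∀ i, i ∉ Set.range s → x' i = x i) (α : ℝ)
    (hle : ∑ k, ((x (s k) - x (par k)) ^ 2 - α * x (s k) ^ 2) ≤
      ∑ k, ((x' (s k) - x' (par' k)) ^ 2 - α * x' (s k) ^ 2)) :
    x ⬝ᵥ (G.lapMatrix ℝ).mulVec x - α * (x ⬝ᵥ x) ≤
      x' ⬝ᵥ (G'.lapMatrix ℝ).mulVec x' - α * (x' ⬝ᵥ x') := by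
  classical
  have hsq : ∀ y : V → ℝ, y ⬝ᵥ y =
      (∑ i, if i ∉ Set.range s then y i ^ 2 else 0) + ∑ k, y (s k) ^ 2 := by
    intro y
    rw [← Finset.sum_image (f := fun i => y i ^ 2) (s := Finset.univ) (g := s) hs.injOn,
      ← Finset.sum_filter, add_comm]
    have : Finset.univ.filter (fun i => i ∉ Set.range s) = (Finset.univ.image s)ᶜ := by
      ext i; simp
    rw [this, Finset.sum_add_sum_compl]
    simp [dotProduct, sq]
  rw [lapMatrix_quadratic_form, lapMatrix_quadratic_form,
    sum_adj_eq_sum_rest_add G s par hs hedge hanti (fun i j => (x i - x j) ^ 2)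
      (fun i j => by ring),
    sum_adj_eq_sum_rest_add G' s par' hs hedge' hanti' (fun i j => (x' i - x' j) ^ 2)
      (fun i j => by ring), hsq, hsq]
  have r1 : (∑ i, if i ∉ Set.range s then x' i ^ 2 else 0)
      = ∑ i, if i ∉ Set.range s then x i ^ 2 else 0 :=
    Finset.sum_congr rfl fun i _ => by
      by_cases h : i ∉ Set.range s
      · rw [hx i h]
      · rw [if_neg h, if_neg h]
  have r2 : (∑ i, ∑ j, if G'.Adj i j ∧ i ∉ Set.range s ∧ j ∉ Set.range s
        then (x' i - x' j) ^ 2 else 0)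
      = ∑ i, ∑ j, if G.Adj i j ∧ i ∉ Set.range s ∧ j ∉ Set.range s
        then (x i - x j) ^ 2 else 0 :=
    Finset.sum_congr rfl fun i _ => Finset.sum_congr rfl fun j _ => by
      by_cases h : i ∉ Set.range s ∧ j ∉ Set.range s
      · simp only [hrest i j h.1 h.2, hx i h.1, hx j h.2]
      · rw [if_neg (fun h' => h h'.2), if_neg (fun h' => h h'.2)]
  rw [r1, r2]
  simp only [Finset.sum_sub_distrib, ← Finset.mul_sum] at hle
  linarith

/-- The vertices of a sun (centre `v`, pendant `P₂`'s `a i, b i`) together with the neighbour `p`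
of its centre. -/
def sunVertex {V : Type*} {r : ℕ} (p v : V) (a b : Fin r → V) : Bool ⊕ Fin r ⊕ Fin r → V :=
  Sum.elim (fun c => cond c p v) (Sum.elim a b)

/-- The parents of the vertices `sunVertex p v a b` when `p` hangs from `u` and the `a i` hang
from `c`. -/
def sunParent {V : Type*} {r : ℕ} (u p c : V) (a : Fin r → V) : Bool ⊕ Fin r ⊕ Fin r → V :=
  Sum.elim (fun c => cond c u p) (Sum.elim (fun _ => c) a)

/-- The linear change of variables comparing the Laplacian forms before and after the star-up
transform. -/
noncomputable def starUpMap {V : Type*} [DecidableEq V] {r : ℕ} (u p v : V) (a b : Fin r → V)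
    (k c d l m : ℝ) : (V → ℝ) →ₗ[ℝ] (V → ℝ) where
  toFun x w := open Classical in
    if w = p then k * x p else if w = v then c * x v + d * x p
    else if w ∈ Set.range a then x w + (x u - x v) * l
    else if w ∈ Set.range b then x w - (x u - x v) * m else x w
  map_add' x y := by
    funext w
    simp only [Pi.add_apply]
    split_ifs <;> ring
  map_smul' t x := by
    funext w
    simp only [Pi.smul_apply, smul_eq_mul, RingHom.id_apply]
    split_ifs <;> ring

theorem starUpMap_injective {V : Type*} [DecidableEq V] {r : ℕ} {u p v : V} {a b : Fin r → V}
    {k c d l m : ℝ} (hk : k ≠ 0) (hc : c ≠ 0) (hpv : p ≠ v)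
    (hu : u ∉ Set.range (sunVertex p v a b)) :
    Function.Injective (starUpMap u p v a b k c d l m) := by
  classical
  rw [← LinearMap.ker_eq_bot, LinearMap.ker_eq_bot']
  intro x hx
  have hx' : ∀ w, (if w = p then k * x p else if w = v then c * x v + d * x p
    else if w ∈ Set.range a then x w + (x u - x v) * l
    else if w ∈ Set.range b then x w - (x u - x v) * m else x w) = 0 := fun w => by
      simpa [starUpMap] using congrFun hx w
  have hp : x p = 0 := by simpa [hk] using hx' p
  have hv : x v = 0 := by simpa [hpv.symm, hp, hc] using hx' v
  have hxu : x u = 0 := by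
    have h := hx' u
    rwa [if_neg, if_neg, if_neg, if_neg] at h
    · rintro ⟨i, rfl⟩; exact hu ⟨.inr (.inr i), rfl⟩
    · rintro ⟨i, rfl⟩; exact hu ⟨.inr (.inl i), rfl⟩
    · rintro rfl; exact hu ⟨.inl false, rfl⟩
    · rintro rfl; exact hu ⟨.inl true, rfl⟩
  funext w
  have h := hx' w
  simp only [hp, hv, hxu, sub_zero, zero_mul, mul_zero, add_zero] at h
  split_ifs at h with h1 h2
  · simpa [h1] using hp
  · simpa [h2] using hv
  all_goals simpa using h

/-- The part of the shifted Laplacian form touching the sun does not decrease under `starUpMap`. -/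
theorem sun_shifted_form_le {V : Type*} [DecidableEq V] {r : ℕ} {u p v : V} {a b : Fin r → V}
    (hs : Function.Injective (sunVertex p v a b)) (hu : u ∉ Set.range (sunVertex p v a b))
    {ε : ℝ} (h0 : 0 < ε) (h1 : ε < 1) {τ : ℝ} (hτ : 0 < τ)
    (hτr : τ = 1 - ε - r * (1 - (ε + 1 / (1 - ε))⁻¹)) (hle : τ ≤ 1 - ε) (x x' : V → ℝ)
    (hx' : x' = starUpMap u p v a b ((ε + 1 / τ) / (ε + 1 / (1 - ε))) (τ / (1 - ε))
      (1 / (1 - ε) - (ε + 1 / τ) / (ε + 1 / (1 - ε)) / (1 - ε))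
      (ε + 1 / (1 - ε))⁻¹ ((ε + 1 / (1 - ε))⁻¹ / (1 - ε)) x) :
    ∑ k, ((x (sunVertex p v a b k) - x (sunParent u p v a k)) ^ 2
        - (2 - ε) * x (sunVertex p v a b k) ^ 2) ≤
      ∑ k, ((x' (sunVertex p v a b k) - x' (sunParent u p u a k)) ^ 2
        - (2 - ε) * x' (sunVertex p v a b k) ^ 2) := by
  have hvp : v ≠ p := fun h => by
    have := @hs (.inl true) (.inl false) h.symm; simp at this
  have hap : ∀ i, a i ≠ p := fun i h => by
    have := @hs (.inr (.inl i)) (.inl true) h; simp at this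
  have hav : ∀ i, a i ≠ v := fun i h => by
    have := @hs (.inr (.inl i)) (.inl false) h; simp at this
  have hbp : ∀ i, b i ≠ p := fun i h => by
    have := @hs (.inr (.inr i)) (.inl true) h; simp at this
  have hbv : ∀ i, b i ≠ v := fun i h => by
    have := @hs (.inr (.inr i)) (.inl false) h; simp at this
  have hba : ∀ i j, a j ≠ b i := fun i j h => by
    have := @hs (.inr (.inl j)) (.inr (.inr i)) h; simp at this
  have hup : u ≠ p := fun h => hu ⟨.inl true, h.symm⟩
  have huv : u ≠ v := fun h => hu ⟨.inl false, h.symm⟩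
  have hua : ∀ i, a i ≠ u := fun i h => hu ⟨.inr (.inl i), h⟩
  have hub : ∀ i, b i ≠ u := fun i h => hu ⟨.inr (.inr i), h⟩
  have xu : x' u = x u := by simp [hx', starUpMap, hup, huv, hua, hub]
  have xp : x' p = (ε + 1 / τ) / (ε + 1 / (1 - ε)) * x p := by simp [hx', starUpMap]
  have xv : x' v = τ / (1 - ε) * x v
      + (1 / (1 - ε) - (ε + 1 / τ) / (ε + 1 / (1 - ε)) / (1 - ε)) * x p := by
    simp [hx', starUpMap, hvp]
  have xa : ∀ i, x' (a i) = x (a i) + (x u - x v) * (ε + 1 / (1 - ε))⁻¹ := fun i => by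
    simp [hx', starUpMap, hap, hav]
  have xb : ∀ i, x' (b i) = x (b i) - (x u - x v) * (ε + 1 / (1 - ε))⁻¹ / (1 - ε) := fun i => by
    simp [hx', starUpMap, hbp, hbv, hba, mul_div_assoc]
  have hP : ∑ i : Fin r, ((x' (a i) - x' u) ^ 2 + (x' (b i) - x' (a i)) ^ 2
        - (2 - ε) * (x' (a i) ^ 2 + x' (b i) ^ 2))
      = ∑ i : Fin r, ((x (a i) - x v) ^ 2 + (x (b i) - x (a i)) ^ 2
        - (2 - ε) * (x (a i) ^ 2 + x (b i) ^ 2))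
        + r * ((1 - (ε + 1 / (1 - ε))⁻¹) * (x u ^ 2 - x v ^ 2)) := by
    simp_rw [xu, xa, xb, pendant_form_shift h0 h1]
    simp [Finset.sum_add_distrib]
  have hQ := path_form_le h0 rfl hτ hle (x u) (x p) (x v)
  rw [← xp, ← xv] at hQ
  simp only [Fintype.sum_sum_type, Fintype.sum_bool, sunVertex, sunParent, Sum.elim_inl,
    Sum.elim_inr, cond_true, cond_false]
  simp only [Finset.sum_sub_distrib, Finset.sum_add_distrib, mul_add, ← Finset.mul_sum] at hP ⊢
  have hδ : r * (1 - (ε + 1 / (1 - ε))⁻¹) = 1 - ε - τ := by linarith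
  rw [← mul_assoc, hδ] at hP
  rw [xu] at hP ⊢
  linarith

theorem sun_coefficient_bounds {n r : ℕ} (hn : 8 ≤ n) (hr : r ≤ n / 4 - 1) {ε : ℝ}
    (hε : ε = 2 / n) :
    0 < 1 - ε - r * (1 - (ε + 1 / (1 - ε))⁻¹) ∧
      1 - ε - r * (1 - (ε + 1 / (1 - ε))⁻¹) ≤ 1 - ε := by
  have hn' : (8 : ℝ) ≤ n := by exact_mod_cast hn
  have hr' : ((r : ℝ) + 1) * 4 ≤ n := by
    have : (r + 1) * 4 ≤ n := by omega
    exact_mod_cast this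
  have h0 : 0 < ε := by rw [hε]; positivity
  have hεn : ε * n = 2 := by rw [hε]; field_simp
  have hε4 : ε ≤ 1 / 4 := by rw [hε, div_le_iff₀ (by positivity)]; linarith
  have ht : 0 < 1 - ε := by linarith
  have hx : 0 < ε * (1 - ε) + 1 := by positivity
  have e : (ε + 1 / (1 - ε))⁻¹ = (1 - ε) / (ε * (1 - ε) + 1) := by
    rw [← inv_div]; field_simp
  have hδ : 1 - (ε + 1 / (1 - ε))⁻¹ = (2 * ε - ε ^ 2) / (ε * (1 - ε) + 1) := by
    rw [e]; field_simp; ring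
  have hδ0 : 0 ≤ 1 - (ε + 1 / (1 - ε))⁻¹ := by
    rw [hδ]; exact div_nonneg (by nlinarith) hx.le
  have hδ1 : 1 - (ε + 1 / (1 - ε))⁻¹ ≤ 2 * ε := by
    rw [hδ, div_le_iff₀ hx]; nlinarith [mul_pos h0 (mul_pos h0 ht)]
  have hrε : ((r : ℝ) + 1) * 4 * ε ≤ 2 := by nlinarith
  have hr0 : (0 : ℝ) ≤ r := Nat.cast_nonneg r
  constructor
  · nlinarith [mul_le_mul_of_nonneg_left hδ1 hr0]
  · nlinarith [mul_nonneg hr0 hδ0]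

/-- The star-up transform in terms of the neighbourhoods of the vertices involved. -/
theorem card_eigenvalues_le_of_sun {V : Type*} [Fintype V] [DecidableEq V]
    (T T' : SimpleGraph V) [DecidableRel T.Adj] [DecidableRel T'.Adj]
    (hn : 8 ≤ Fintype.card V) {r : ℕ} (hr : r ≤ Fintype.card V / 4 - 1)
    {u p v : V} {a b : Fin r → V}
    (hs : Function.Injective (sunVertex p v a b)) (hu : u ∉ Set.range (sunVertex p v a b))
    (hp : ∀ x, T.Adj p x ↔ x = u ∨ x = v) (hv : ∀ x, T.Adj v x ↔ x = p ∨ ∃ i, x = a i)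
    (ha : ∀ i x, T.Adj (a i) x ↔ x = v ∨ x = b i) (hb : ∀ i x, T.Adj (b i) x ↔ x = a i)
    (hp' : ∀ x, T'.Adj p x ↔ x = u ∨ x = v) (hv' : ∀ x, T'.Adj v x ↔ x = p)
    (ha' : ∀ i x, T'.Adj (a i) x ↔ x = u ∨ x = b i) (hb' : ∀ i x, T'.Adj (b i) x ↔ x = a i)
    (hrest : ∀ x y, x ∉ Set.range (sunVertex p v a b) → y ∉ Set.range (sunVertex p v a b) →
      (T.Adj x y ↔ T'.Adj x y)) :
    Nat.card {i // 2 - 2 / (Fintype.card V : ℝ) ≤ (lapHerm T).eigenvalues i} ≤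
    Nat.card {i // 2 - 2 / (Fintype.card V : ℝ) ≤ (lapHerm T').eigenvalues i} := by
  obtain ⟨ε, hε⟩ : ∃ ε : ℝ, ε = 2 / (Fintype.card V : ℝ) := ⟨_, rfl⟩
  have hn' : (8 : ℝ) ≤ Fintype.card V := by exact_mod_cast hn
  have h0 : 0 < ε := by rw [hε]; positivity
  have h1 : ε < 1 := by rw [hε, div_lt_one (by positivity)]; linarith
  obtain ⟨hτ, hle⟩ := sun_coefficient_bounds hn hr hε
  have hvp : v ≠ p := fun h => by
    have := @hs (.inl true) (.inl false) h.symm; simp at this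
  have hap : ∀ i, a i ≠ p := fun i h => by
    have := @hs (.inr (.inl i)) (.inl true) h; simp at this
  have hav : ∀ i, a i ≠ v := fun i h => by
    have := @hs (.inr (.inl i)) (.inl false) h; simp at this
  have hbp : ∀ i, b i ≠ p := fun i h => by
    have := @hs (.inr (.inr i)) (.inl true) h; simp at this
  have hbv : ∀ i, b i ≠ v := fun i h => by
    have := @hs (.inr (.inr i)) (.inl false) h; simp at this
  have hba : ∀ i j, a j ≠ b i := fun i j h => by
    have := @hs (.inr (.inl j)) (.inr (.inr i)) h; simp at this
  have haa : ∀ i j, a i = a j ↔ i = j := fun i j =>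
    ⟨fun h => by simpa using @hs (.inr (.inl i)) (.inr (.inl j)) h, fun h => h ▸ rfl⟩
  have hup : u ≠ p := fun h => hu ⟨.inl true, h.symm⟩
  have huv : u ≠ v := fun h => hu ⟨.inl false, h.symm⟩
  have hua : ∀ i, a i ≠ u := fun i h => hu ⟨.inr (.inl i), h⟩
  have hub : ∀ i, b i ≠ u := fun i h => hu ⟨.inr (.inr i), h⟩
  rw [← hε]
  have ht : 0 < 1 - ε := by linarith
  refine card_eigenvalues_le_of_injective (lapHerm T) (lapHerm T') (2 - ε)
    (starUpMap u p v a b _ _ _ _ _)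
    (starUpMap_injective ?_ ?_ hvp.symm hu) fun x =>
    shifted_form_le_of_rest_eq T T' (sunVertex p v a b) (sunParent u p v a) (sunParent u p u a)
      hs ?_ ?_ ?_ ?_ hrest x _ ?_ (2 - ε) (sun_shifted_form_le hs hu h0 h1 hτ rfl hle x _ rfl)
  · positivity
  · positivity
  · rintro ((_ | _) | i | i) y <;>
      simp [sunVertex, sunParent, Sum.exists, *, Ne.symm, eq_comm]
    all_goals grind
  · rintro ((_ | _) | i | i) ((_ | _) | j | j) <;>
      simp [sunVertex, sunParent, *, Ne.symm]
  · rintro ((_ | _) | i | i) y <;>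
      simp [sunVertex, sunParent, Sum.exists, *, Ne.symm, eq_comm]
    all_goals grind
  · rintro ((_ | _) | i | i) ((_ | _) | j | j) <;>
      simp [sunVertex, sunParent, *, Ne.symm]
  · intro w hw
    have e1 : w ≠ p := fun h => hw ⟨.inl true, h.symm⟩
    have e2 : w ≠ v := fun h => hw ⟨.inl false, h.symm⟩
    have e3 : ∀ i, a i ≠ w := fun i h => hw ⟨.inr (.inl i), h⟩
    have e4 : ∀ i, b i ≠ w := fun i h => hw ⟨.inr (.inr i), h⟩
    simp [starUpMap, e1, e2, e3, e4]

theorem SimpleGraph.adj_iff_of_degree_le_card {V : Type*} [Fintype V] [DecidableEq V]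
    (G : SimpleGraph V) [DecidableRel G.Adj] {x : V} {S : Finset V}
    (hS : ∀ y ∈ S, G.Adj x y) (hd : G.degree x ≤ S.card) (y : V) : G.Adj x y ↔ y ∈ S := by
  have : S = G.neighborFinset x :=
    Finset.eq_of_subset_of_card_le (fun y hy => by simpa using hS y hy) hd
  rw [this, SimpleGraph.mem_neighborFinset]

/-- **Star-up transform is proper.**  Let `T` be a tree on `n ≥ 8` vertices, let
`u = w 0` be a non-leaf vertex carrying a path `w 0, w 1, …, w q` (`q ≥ 2`)
whose internal vertices have degree 2, ending at a vertex `w q` of degree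
`r + 1` with exactly `r` pendant `P₂`'s (with middles `a i` and leaves `b i`),
where `0 ≤ r ≤ ⌊n/4⌋ - 1`.  Let `T'` be the tree obtained by shortening the
path by two edges: the edges `w q — a i` are replaced by edges
`w (q-2) — a i` (so `w (q-1), w q` becomes an extra pendant `P₂` at `w (q-2)`),
everything else being unchanged.  Then the number of Laplacian eigenvalues
`≥ 2 - 2/n` does not decrease from `T` to `T'`. -/
theorem starUp_proper {V : Type*} [Fintype V] [DecidableEq V]
    (T T' : SimpleGraph V) [DecidableRel T.Adj] [DecidableRel T'.Adj]
    (hn : 8 ≤ Fintype.card V) (hT : T.IsTree)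
    (q r : ℕ) (hq : 2 ≤ q) (hr : r ≤ Fintype.card V / 4 - 1)
    (w : Fin (q + 1) → V) (a b : Fin r → V)
    (hinj : Function.Injective (Sum.elim w (Sum.elim a b)))
    (hu : 2 ≤ T.degree (w 0))
    (hpath : ∀ i : Fin q, T.Adj (w i.castSucc) (w i.succ))
    (hint : ∀ i : Fin (q + 1), i ≠ 0 → i ≠ Fin.last q → T.degree (w i) = 2)
    (hsun : ∀ i, T.Adj (w (Fin.last q)) (a i))
    (hP2 : ∀ i, T.Adj (a i) (b i))
    (hdega : ∀ i, T.degree (a i) = 2)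
    (hdegb : ∀ i, T.degree (b i) = 1)
    (hdegw : T.degree (w (Fin.last q)) = r + 1)
    (hT' : ∀ x y, T'.Adj x y ↔
      (T.Adj x y ∧
        ∀ i, ¬((x = w (Fin.last q) ∧ y = a i) ∨ (x = a i ∧ y = w (Fin.last q)))) ∨
      (∃ i, (x = w ⟨q - 2, by omega⟩ ∧ y = a i) ∨
            (x = a i ∧ y = w ⟨q - 2, by omega⟩))) :
    Nat.card {i // 2 - 2 / (Fintype.card V : ℝ) ≤ (lapHerm T).eigenvalues i} ≤
    Nat.card {i // 2 - 2 / (Fintype.card V : ℝ) ≤ (lapHerm T').eigenvalues i} := by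
  obtain ⟨m, rfl⟩ : ∃ m, q = m + 2 := ⟨q - 2, by omega⟩
  set u := w ⟨m + 2 - 2, by omega⟩
  set p := w ⟨m + 1, by omega⟩
  set v := w (Fin.last (m + 2))
  have hw : Function.Injective w := fun i j h => by
    simpa using @hinj (.inl i) (.inl j) h
  have ha_inj : Function.Injective a := fun i j h => by
    simpa using @hinj (.inr (.inl i)) (.inr (.inl j)) h
  have hb_inj : Function.Injective b := fun i j h => by
    simpa using @hinj (.inr (.inr i)) (.inr (.inr j)) h
  have hwa : ∀ i j, w i ≠ a j := fun i j h => by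
    have := @hinj (.inl i) (.inr (.inl j)) h; simp at this
  have hwb : ∀ i j, w i ≠ b j := fun i j h => by
    have := @hinj (.inl i) (.inr (.inr j)) h; simp at this
  have hab : ∀ i j, a i ≠ b j := fun i j h => by
    have := @hinj (.inr (.inl i)) (.inr (.inr j)) h; simp at this
  have hup : u ≠ p := fun h => by simpa [Fin.ext_iff] using hw h
  have huv : u ≠ v := fun h => by simpa [Fin.ext_iff] using hw h
  have hpv : p ≠ v := fun h => by simpa [Fin.ext_iff] using hw h
  have hua : ∀ i, u ≠ a i := fun i => hwa _ i
  have hub : ∀ i, u ≠ b i := fun i => hwb _ i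
  have hpa : ∀ i, p ≠ a i := fun i => hwa _ i
  have hpb : ∀ i, p ≠ b i := fun i => hwb _ i
  have hva : ∀ i, v ≠ a i := fun i => hwa _ i
  have hvb : ∀ i, v ≠ b i := fun i => hwb _ i
  have hadj_up : T.Adj u p := hpath ⟨m, by omega⟩
  have hadj_pv : T.Adj p v := hpath ⟨m + 1, by omega⟩
  have hp : ∀ x, T.Adj p x ↔ x = u ∨ x = v := fun x => by
    have := T.adj_iff_of_degree_le_card (x := p) (S := {u, v})
      (by simp [hadj_up.symm, hadj_pv])
      (by rw [Finset.card_pair huv]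
          exact (hint _ (by simp [Fin.ext_iff]) (by simp [Fin.ext_iff])).le) x
    simpa using this
  have hv : ∀ x, T.Adj v x ↔ x = p ∨ ∃ i, x = a i := fun x => by
    have := T.adj_iff_of_degree_le_card (x := v) (S := insert p (Finset.univ.image a))
      (by simpa [hadj_pv.symm] using hsun)
      (by rw [Finset.card_insert_of_notMem (by simpa using fun i => (hpa i).symm),
            Finset.card_image_of_injective _ ha_inj, Finset.card_univ, Fintype.card_fin, hdegw]) x
    simpa [eq_comm] using this
  have ha : ∀ i x, T.Adj (a i) x ↔ x = v ∨ x = b i := fun i x => by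
    have := T.adj_iff_of_degree_le_card (x := a i) (S := {v, b i})
      (by simp [(hsun i).symm, hP2 i]) (by rw [Finset.card_pair (hvb i), hdega]) x
    simpa using this
  have hb : ∀ i x, T.Adj (b i) x ↔ x = a i := fun i x => by
    have := T.adj_iff_of_degree_le_card (x := b i) (S := {a i})
      (by simp [(hP2 i).symm]) (by rw [Finset.card_singleton, hdegb]) x
    simpa using this
  refine card_eigenvalues_le_of_sun T T' hn hr (u := u) (p := p) (v := v) (a := a) (b := b)
    ?_ ?_ hp hv ha hb ?_ ?_ ?_ ?_ ?_
  · rintro ((_ | _) | i | i) ((_ | _) | j | j) <;>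
      simp only [sunVertex, Sum.elim_inl, Sum.elim_inr, cond_true, cond_false] <;> grind
  · rintro ⟨(_ | _) | i | i, h⟩ <;> simp [sunVertex] at h <;> grind
  · intro x; rw [hT', hp]; grind
  · intro x; rw [hT', hv]; grind
  · intro i x; rw [hT', ha]; grind
  · intro i x; rw [hT', hb]; grind
  · intro x y hx hy
    have hxa : ∀ i, x ≠ a i := fun i h => hx ⟨.inr (.inl i), h.symm⟩
    have hya : ∀ i, y ≠ a i := fun i h => hy ⟨.inr (.inl i), h.symm⟩
    rw [hT']; grind
end

section
/- (Star-down transform is proper.) Let T be a tree on n ≥ 8 vertices and let u be a vertex of T such that: u is adjacent to a vertex w of degree r + 1 whose other r neighbors each begin a pendant P_2 attached at w (so exactly r pendant P_2's are attached at w), where 0 ≤ r ≤ ⌊n/4⌋ − 1; and u also has a pendant path of length 2 attached at u, say u, a, b. Let T′ be the tree on n vertices obtained from T by deleting the vertices a and b and attaching a new pendant path of length 2 at w, leaving everything else unchanged. Then the number of Laplacian eigenvalues of T′ that are ≥ 2 − 2/n is at least the number of Laplacian eigenvalues of T that are ≥ 2 − 2/n. -/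
open Matrix

theorem Matrix.IsHermitian.exists_orthogonal_diagonalization {V : Type*} [Fintype V] [DecidableEq V]
    {A : Matrix V V ℝ} (hA : A.IsHermitian) :
    ∃ U : Matrix V V ℝ, Uᵀ * U = 1 ∧ U * Uᵀ = 1 ∧ A = U * diagonal hA.eigenvalues * Uᵀ := by
  refine ⟨hA.eigenvectorUnitary, ?_, ?_, ?_⟩
  · simpa [star_eq_conjTranspose] using Unitary.coe_star_mul_self hA.eigenvectorUnitary
  · simpa [star_eq_conjTranspose] using Unitary.coe_mul_star_self hA.eigenvectorUnitary
  · conv_lhs => rw [hA.spectral_theorem]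
    simp [Unitary.conjStarAlgAut_apply, star_eq_conjTranspose]

/-- The shifted quadratic form in eigencoordinates. -/
theorem quadForm_sub_eq_sum {V : Type*} [Fintype V] [DecidableEq V] {A U : Matrix V V ℝ}
    {l : V → ℝ} (hU : Uᵀ * U = 1) (hA : A = U * diagonal l * Uᵀ) (α : ℝ) (c : V → ℝ) :
    (U *ᵥ c) ⬝ᵥ A *ᵥ (U *ᵥ c) - α * ((U *ᵥ c) ⬝ᵥ (U *ᵥ c)) = ∑ i, (l i - α) * c i ^ 2 := by
  have h1 : (U *ᵥ c) ⬝ᵥ (U *ᵥ c) = c ⬝ᵥ c := by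
    rw [dotProduct_mulVec, ← mulVec_transpose, mulVec_mulVec, hU, one_mulVec]
  have h2 : A *ᵥ (U *ᵥ c) = U *ᵥ (diagonal l *ᵥ c) := by
    rw [hA, mulVec_mulVec, Matrix.mul_assoc _ Uᵀ U, hU, Matrix.mul_one, mulVec_mulVec]
  have h3 : (U *ᵥ c) ⬝ᵥ U *ᵥ (diagonal l *ᵥ c) = c ⬝ᵥ (diagonal l *ᵥ c) := by
    rw [dotProduct_mulVec, ← mulVec_transpose, mulVec_mulVec, hU, one_mulVec]
  rw [h2, h3, h1]
  simp only [dotProduct, mulVec_diagonal, Finset.mul_sum, ← Finset.sum_sub_distrib]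
  exact Finset.sum_congr rfl fun i _ => by ring

/-- If an injective linear substitution does not decrease the quadratic form shifted by `α`,
then the number of eigenvalues `≥ α` does not decrease. -/
theorem card_eigenvalues_ge_le_of_quadForm_le {V : Type*} [Fintype V] [DecidableEq V]
    {A B : Matrix V V ℝ} (hA : A.IsHermitian) (hB : B.IsHermitian) (α : ℝ)
    (S : (V → ℝ) →ₗ[ℝ] V → ℝ) (hS : Function.Injective S)
    (h : ∀ x, x ⬝ᵥ A *ᵥ x - α * (x ⬝ᵥ x) ≤ S x ⬝ᵥ B *ᵥ S x - α * (S x ⬝ᵥ S x)) :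
    Nat.card {i // α ≤ hA.eigenvalues i} ≤ Nat.card {i // α ≤ hB.eigenvalues i} := by
  obtain ⟨U, hU, -, hAU⟩ := hA.exists_orthogonal_diagonalization
  obtain ⟨W, hW, hW', hBW⟩ := hB.exists_orthogonal_diagonalization
  let E : ({i // α ≤ hA.eigenvalues i} → ℝ) →ₗ[ℝ] V → ℝ :=
    Function.ExtendByZero.linearMap ℝ Subtype.val
  let Φ : ({i // α ≤ hA.eigenvalues i} → ℝ) →ₗ[ℝ] {i // α ≤ hB.eigenvalues i} → ℝ :=
    LinearMap.funLeft ℝ ℝ Subtype.val ∘ₗ Wᵀ.mulVecLin ∘ₗ S ∘ₗ U.mulVecLin ∘ₗ E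
  have hΦ : Function.Injective Φ := by
    rw [injective_iff_map_eq_zero]
    intro c hc
    set e := E c with he
    set d := Wᵀ *ᵥ S (U *ᵥ e) with hd
    have hSd : S (U *ᵥ e) = W *ᵥ d := by rw [hd, mulVec_mulVec, hW', one_mulVec]
    have hd0 : ∀ j, α ≤ hB.eigenvalues j → d j = 0 := fun j hj => congrFun hc ⟨j, hj⟩
    have he0 : ∀ i, ¬ α ≤ hA.eigenvalues i → e i = 0 := fun i hi =>
      Function.extend_apply' _ _ _ (by rintro ⟨⟨j, hj⟩, rfl⟩; exact hi hj)
    have key := h (U *ᵥ e)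
    rw [hSd, quadForm_sub_eq_sum hU hAU, quadForm_sub_eq_sum hW hBW] at key
    have hpos : 0 ≤ ∑ i, (hA.eigenvalues i - α) * e i ^ 2 := by
      refine Finset.sum_nonneg fun i _ => ?_
      by_cases hi : α ≤ hA.eigenvalues i
      · exact mul_nonneg (by linarith) (sq_nonneg _)
      · simp [he0 i hi]
    have hneg : ∀ j ∈ Finset.univ, (hB.eigenvalues j - α) * d j ^ 2 ≤ 0 := by
      intro j _
      by_cases hj : α ≤ hB.eigenvalues j
      · simp [hd0 j hj]
      · exact mul_nonpos_of_nonpos_of_nonneg (by linarith) (sq_nonneg _)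
    have hzero := (Finset.sum_eq_zero_iff_of_nonpos hneg).1
      (le_antisymm (Finset.sum_nonpos hneg) (hpos.trans key))
    have hdz : d = 0 := by
      funext j
      by_cases hj : α ≤ hB.eigenvalues j
      · exact hd0 j hj
      · rcases mul_eq_zero.1 (hzero j (Finset.mem_univ j)) with h' | h'
        · linarith
        · simpa using h'
    rw [hdz, mulVec_zero] at hSd
    have hUe : U *ᵥ e = 0 := hS (by rw [hSd, map_zero])
    have hez : e = 0 := by
      rw [← one_mulVec e, ← hU, ← mulVec_mulVec, hUe, mulVec_zero]
    funext i
    have := congrFun hez i.1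
    rwa [he, show E c i.1 = c i from Subtype.val_injective.extend_apply _ _ _] at this
  simpa [Nat.card_eq_fintype_card] using LinearMap.finrank_le_finrank_of_injective hΦ

theorem Matrix.IsSymm.dotProduct_mulVec_add_sub {V : Type*} [Fintype V] {A : Matrix V V ℝ}
    (hA : A.IsSymm) (x d : V → ℝ) :
    (x + d) ⬝ᵥ A *ᵥ (x + d) - x ⬝ᵥ A *ᵥ x = d ⬝ᵥ A *ᵥ (x + (x + d)) := by
  have h : x ⬝ᵥ A *ᵥ d = d ⬝ᵥ A *ᵥ x := by
    rw [dotProduct_mulVec, ← mulVec_transpose, hA.eq, dotProduct_comm]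
  simp only [mulVec_add, add_dotProduct, dotProduct_add, h]
  ring

theorem SimpleGraph.lapMatrix_mulVec_apply_of_subset {V : Type*} [Fintype V] [DecidableEq V]
    (G : SimpleGraph V) [DecidableRel G.Adj] {v : V} {s : Finset V} (hs : ∀ x ∈ s, G.Adj v x)
    (hcard : G.degree v = s.card) (z : V → ℝ) :
    (G.lapMatrix ℝ *ᵥ z) v = s.card * z v - ∑ x ∈ s, z x := by
  have : s = G.neighborFinset v :=
    Finset.eq_of_subset_of_card_le (fun x hx => (G.mem_neighborFinset v x).2 (hs x hx)) hcard.le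
  rw [G.lapMatrix_mulVec_apply, ← this, hcard]

/-- The Laplacian form as a sum over ordered pairs. -/
theorem SimpleGraph.dotProduct_lapMatrix_mulVec {V : Type*} [Fintype V] [DecidableEq V]
    (G : SimpleGraph V) [DecidableRel G.Adj] (x : V → ℝ) :
    x ⬝ᵥ G.lapMatrix ℝ *ᵥ x = (∑ i, ∑ j, if G.Adj i j then (x i - x j) ^ 2 else 0) / 2 := by
  rw [← G.lapMatrix_toLinearMap₂' ℝ x, toLinearMap₂'_apply']

/-- Effect on the Laplacian form of replacing the edge `u — p` by the non-edge `w — p`. -/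
theorem dotProduct_lapMatrix_mulVec_moveEdge {V : Type*} [Fintype V] [DecidableEq V]
    {G H : SimpleGraph V} [DecidableRel G.Adj] [DecidableRel H.Adj] {u w p : V}
    (hup : G.Adj u p) (hwp : ¬ G.Adj w p) (hne : w ≠ p)
    (hH : ∀ x y, H.Adj x y ↔ (G.Adj x y ∧ ¬((x = u ∧ y = p) ∨ (x = p ∧ y = u))) ∨
      ((x = w ∧ y = p) ∨ (x = p ∧ y = w))) (y : V → ℝ) :
    y ⬝ᵥ H.lapMatrix ℝ *ᵥ y =
      y ⬝ᵥ G.lapMatrix ℝ *ᵥ y - (y u - y p) ^ 2 + (y w - y p) ^ 2 := by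
  have hpw : ¬ G.Adj p w := fun h => hwp h.symm
  have hpu := hup.symm
  have hne' := hup.ne
  have hsum : ∀ a b : V, ∑ i, ∑ j, (if i = a ∧ j = b then (y i - y j) ^ 2 else 0) =
      (y a - y b) ^ 2 := by
    intro a b
    simp [ite_and]
  have hterm : ∀ i j, (if H.Adj i j then (y i - y j) ^ 2 else 0) =
      (if G.Adj i j then (y i - y j) ^ 2 else 0)
      - (if i = u ∧ j = p then (y i - y j) ^ 2 else 0)
      - (if i = p ∧ j = u then (y i - y j) ^ 2 else 0)
      + (if i = w ∧ j = p then (y i - y j) ^ 2 else 0)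
      + (if i = p ∧ j = w then (y i - y j) ^ 2 else 0) := by
    intro i j
    have := hH i j
    grind
  simp only [SimpleGraph.dotProduct_lapMatrix_mulVec, hterm, Finset.sum_add_distrib,
    Finset.sum_sub_distrib, hsum]
  ring

/-- The Schur complement of the form at the branching vertex, before and after the move,
lies in the interval `(-1, 0)`. -/
theorem pivot_bounds {ε β m r : ℝ} (hε : 0 < ε) (hε' : ε ≤ 1 / 4) (hr : 0 ≤ r)
    (hr' : (r + 1) * (2 * ε) ≤ 1) (hβ : β * (1 - ε) = 1) (hm : m = ε + β) :
    1 < m ∧ -1 < r - 1 + ε - r / m ∧ r - 1 + ε - r / m + (1 - 1 / m) < 0 := by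
  have hβ1 : 1 < β := by nlinarith
  have hm1 : 1 < m := by linarith
  have hm0 : 0 < m := by linarith
  refine ⟨hm1, ?_, ?_⟩
  · have : r / m ≤ r := div_le_self hr hm1.le
    linarith
  · have key : (r + 1) * (m - 1) < (1 - ε) * m := by
      have h1 : (m - 1) * (1 - ε) = ε * (2 - ε) := by rw [hm]; linear_combination hβ
      have h2 : m * (1 - ε) = 1 + ε - ε ^ 2 := by rw [hm]; linear_combination hβ
      have h3 : (r + 1) * (m - 1) * (1 - ε) < (1 - ε) * m * (1 - ε) := by
        nlinarith [mul_le_mul_of_nonneg_right hr' (by linarith : 0 ≤ 2 - ε), mul_pos hε hε]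
      exact lt_of_mul_lt_mul_right h3 (by linarith)
    have : r - 1 + ε - r / m + (1 - 1 / m) = ((r + 1) * (m - 1) - (1 - ε) * m) / m := by
      field_simp
      ring
    rw [this]
    exact div_neg_of_neg_of_pos (by linarith) hm0

theorem reduced_form_nonneg {m δ δ' k x s : ℝ} (hm : 1 < m) (hδ : -1 < δ) (hδ' : δ' < 0)
    (hδδ' : δ' = δ + (1 - 1 / m)) (hk : k = 1 / δ' - 1 / δ) :
    0 ≤ (1 - 1 / m) * ((x + k * s) ^ 2 - s ^ 2) + k * s * (δ * (2 * x + k * s) - 2 * s) := by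
  have hg : 0 < 1 - 1 / m := by
    rw [sub_pos, div_lt_one (by linarith)]
    exact hm
  set g := 1 - 1 / m
  have hδ0 : δ < 0 := by linarith
  have hne := hδ0.ne
  have hne' := hδ'.ne
  have hp : 0 < δ * δ' := mul_pos_of_neg_of_neg hδ0 hδ'
  have hp1 : δ * δ' ≤ 1 := by nlinarith
  have hgd : g = δ' - δ := by linarith
  have : g * ((x + k * s) ^ 2 - s ^ 2) + k * s * (δ * (2 * x + k * s) - 2 * s) =
      g * (x - s / δ) ^ 2 + s ^ 2 * g * (1 / (δ * δ') - 1) := by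
    rw [hgd, hk]
    field_simp
    ring
  rw [this]
  have h1 : 0 ≤ 1 / (δ * δ') - 1 := by
    rw [sub_nonneg, le_div_iff₀ hp]
    linarith
  positivity

/-- **Star-down transform is proper.**  Let `T` be a tree on `n ≥ 8` vertices,
let `u` be adjacent to a vertex `wv` of degree `r + 1` carrying exactly `r`
pendant `P₂`'s (middles `a i`, leaves `b i`) with `0 ≤ r ≤ ⌊n/4⌋ - 1`, and let
`u` also carry a pendant path of length 2, namely `u, p1, p2`.  Let `T'` be the
tree obtained by deleting the vertices `p1, p2` and attaching a new pendant
`P₂` at `wv` (i.e. the edge `u — p1` is replaced by the edge `wv — p1`),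
everything else being unchanged.  Then the number of Laplacian eigenvalues
`≥ 2 - 2/n` does not decrease from `T` to `T'`. -/
theorem starDown_proper {V : Type*} [Fintype V] [DecidableEq V]
    (T T' : SimpleGraph V) [DecidableRel T.Adj] [DecidableRel T'.Adj]
    (hn : 8 ≤ Fintype.card V) (hT : T.IsTree)
    (r : ℕ) (hr : r ≤ Fintype.card V / 4 - 1)
    (u wv p1 p2 : V) (a b : Fin r → V)
    (hinj : Function.Injective (Sum.elim ![u, wv, p1, p2] (Sum.elim a b)))
    (huw : T.Adj u wv)
    (hdegw : T.degree wv = r + 1)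
    (hsun : ∀ i, T.Adj wv (a i))
    (hP2 : ∀ i, T.Adj (a i) (b i))
    (hdega : ∀ i, T.degree (a i) = 2)
    (hdegb : ∀ i, T.degree (b i) = 1)
    (hup1 : T.Adj u p1) (hp12 : T.Adj p1 p2)
    (hdegp1 : T.degree p1 = 2) (hdegp2 : T.degree p2 = 1)
    (hT' : ∀ x y, T'.Adj x y ↔
      (T.Adj x y ∧ ¬((x = u ∧ y = p1) ∨ (x = p1 ∧ y = u))) ∨
      ((x = wv ∧ y = p1) ∨ (x = p1 ∧ y = wv))) :
    Nat.card {i // 2 - 2 / (Fintype.card V : ℝ) ≤ (lapHerm T).eigenvalues i} ≤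
    Nat.card {i // 2 - 2 / (Fintype.card V : ℝ) ≤ (lapHerm T').eigenvalues i} := by
  obtain ⟨n, hndef⟩ : ∃ n : ℝ, n = Fintype.card V := ⟨_, rfl⟩
  have hn' : (8 : ℝ) ≤ n := by rw [hndef]; exact_mod_cast hn
  obtain ⟨ε, hεdef⟩ : ∃ ε : ℝ, ε = 2 / n := ⟨_, rfl⟩
  have hεn : ε * n = 2 := by rw [hεdef]; field_simp
  have hε : 0 < ε := by rw [hεdef]; positivity
  have hε' : ε ≤ 1 / 4 := by nlinarith
  have hr' : ((r : ℝ) + 1) * (2 * ε) ≤ 1 := by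
    have : (4 * (r + 1) : ℝ) ≤ n := by
      have : 4 * (r + 1) ≤ Fintype.card V := by omega
      rw [hndef]
      exact_mod_cast this
    nlinarith
  rw [← hndef, ← hεdef]
  obtain ⟨β, hβ⟩ : ∃ β : ℝ, β * (1 - ε) = 1 := ⟨(1 - ε)⁻¹, inv_mul_cancel₀ (by linarith)⟩
  obtain ⟨m, hm⟩ : ∃ m : ℝ, m = ε + β := ⟨_, rfl⟩
  obtain ⟨hm1, hδ, hδ'⟩ := pivot_bounds hε hε' (Nat.cast_nonneg r) hr' hβ hm
  obtain ⟨δ, hδdef⟩ : ∃ δ : ℝ, δ = r - 1 + ε - r / m := ⟨_, rfl⟩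
  rw [← hδdef] at hδ hδ'
  obtain ⟨k, hk⟩ : ∃ k : ℝ, k = 1 / (δ + (1 - 1 / m)) - 1 / δ := ⟨_, rfl⟩
  have huw_ne : u ≠ wv := huw.ne
  have hup_ne : u ≠ p1 := hup1.ne
  have hne : ∀ {i j}, Sum.elim ![u, wv, p1, p2] (Sum.elim a b) i =
      Sum.elim ![u, wv, p1, p2] (Sum.elim a b) j → i = j := fun h => hinj h
  have hup2_ne : u ≠ p2 := fun h => by simpa using @hne (.inl 0) (.inl 3) h
  have hwp1_ne : wv ≠ p1 := fun h => by simpa using @hne (.inl 1) (.inl 2) h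
  have hwp2_ne : wv ≠ p2 := fun h => by simpa using @hne (.inl 1) (.inl 3) h
  have hp12_ne : p1 ≠ p2 := hp12.ne
  have hau : ∀ i, u ≠ a i := fun i h => by simpa using @hne (.inl 0) (.inr (.inl i)) h
  have hbu : ∀ i, u ≠ b i := fun i h => by simpa using @hne (.inl 0) (.inr (.inr i)) h
  have haw : ∀ i, wv ≠ a i := fun i h => by simpa using @hne (.inl 1) (.inr (.inl i)) h
  have hbw : ∀ i, wv ≠ b i := fun i h => by simpa using @hne (.inl 1) (.inr (.inr i)) h
  have hap1 : ∀ i, p1 ≠ a i := fun i h => by simpa using @hne (.inl 2) (.inr (.inl i)) h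
  have hbp1 : ∀ i, p1 ≠ b i := fun i h => by simpa using @hne (.inl 2) (.inr (.inr i)) h
  have ha : Function.Injective a := fun i j h => by
    simpa using @hne (.inr (.inl i)) (.inr (.inl j)) h
  -- the rows of the Laplacian of `T` at the vertices of the branch
  have Lw : ∀ z : V → ℝ, (T.lapMatrix ℝ *ᵥ z) wv = (r + 1) * z wv - z u - ∑ i, z (a i) := by
    intro z
    have hu : u ∉ Finset.univ.image a := by simpa using fun i => (hau i).symm
    have hc : (insert u (Finset.univ.image a)).card = r + 1 := by
      rw [Finset.card_insert_of_notMem hu, Finset.card_image_of_injective _ ha, Finset.card_fin]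
    rw [T.lapMatrix_mulVec_apply_of_subset (s := insert u (Finset.univ.image a)) _
      (by rw [hc, hdegw]), hc, Finset.sum_insert hu, Finset.sum_image (fun _ _ _ _ h => ha h)]
    · push_cast
      ring
    · simpa [huw.symm] using hsun
  have Lpair : ∀ {v x y : V}, T.Adj v x → T.Adj v y → x ≠ y → T.degree v = 2 → ∀ z : V → ℝ,
      (T.lapMatrix ℝ *ᵥ z) v = 2 * z v - z x - z y := by
    intro v x y hx hy hxy hd z
    rw [T.lapMatrix_mulVec_apply_of_subset (s := {x, y}) (by simp [hx, hy])
      (by rw [hd, Finset.card_pair hxy]), Finset.card_pair hxy, Finset.sum_pair hxy]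
    push_cast
    ring
  have Lleaf : ∀ {v x : V}, T.Adj v x → T.degree v = 1 → ∀ z : V → ℝ,
      (T.lapMatrix ℝ *ᵥ z) v = z v - z x := by
    intro v x hx hd z
    rw [T.lapMatrix_mulVec_apply_of_subset (s := {x}) (by simp [hx]) (by simp [hd])]
    simp
  have La := fun i => Lpair (hsun i).symm (hP2 i) (hbw i) (hdega i)
  have Lb := fun i => Lleaf (hP2 i).symm (hdegb i)
  have Lp1 := Lpair hup1.symm hp12 hup2_ne hdegp1
  have Lp2 := Lleaf hp12.symm hdegp2
  have hwp1 : ¬ T.Adj wv p1 := by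
    intro h
    have hs : ({u, wv, p2} : Finset V) ⊆ T.neighborFinset p1 := by
      simp [Finset.insert_subset_iff, hup1.symm, h.symm, hp12]
    have := Finset.card_le_card hs
    rw [T.card_neighborFinset_eq_degree, hdegp1, Finset.card_eq_three.2
      ⟨u, wv, p2, huw_ne, hup2_ne, hwp2_ne, rfl⟩] at this
    omega
  -- the substitution adds multiples of two vectors supported on the pendant paths
  let q : V → ℝ := Pi.single wv 1 +
    ∑ i, m⁻¹ • (Pi.single (a i) 1 - β • Pi.single (b i) 1 : V → ℝ)
  let q' : V → ℝ := Pi.single p1 1 - β • Pi.single p2 1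
  have hqu : q u = 0 := by simp [q, huw_ne, hau, hbu]
  have hqw : q wv = 1 := by simp [q, haw, hbw]
  have hqp : q p1 = 0 := by simp [q, hwp1_ne.symm, hap1, hbp1]
  have hq'u : q' u = 0 := by simp [q', hup_ne, hup2_ne]
  have hq'w : q' wv = 0 := by simp [q', hwp1_ne, hwp2_ne]
  have hq'p : q' p1 = 1 := by simp [q', hp12_ne]
  let f : (V → ℝ) →ₗ[ℝ] ℝ := k • LinearMap.proj u
  let g : (V → ℝ) →ₗ[ℝ] ℝ := m⁻¹ • (LinearMap.proj wv + (k - 1) • LinearMap.proj u)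
  let S : (V → ℝ) →ₗ[ℝ] V → ℝ := LinearMap.id + (f.smulRight q + g.smulRight q')
  have hSx : ∀ x, S x = x + (f x • q + g x • q') := fun x => rfl
  have hf : ∀ x, f x = k * x u := fun x => rfl
  have hg : ∀ x, g x = m⁻¹ * (x wv + (k - 1) * x u) := fun x => rfl
  refine card_eigenvalues_ge_le_of_quadForm_le _ _ _ S ?_ fun x => ?_
  · rw [injective_iff_map_eq_zero]
    intro x hx
    have hxu : x u = 0 := by simpa [hSx, hqu, hq'u] using congrFun hx u
    have hxw : x wv = 0 := by simpa [hSx, hqw, hq'w, hf, hxu] using congrFun hx wv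
    simpa [hSx, hf, hg, hxu, hxw] using hx
  · rw [dotProduct_lapMatrix_mulVec_moveEdge hup1 hwp1 hwp1_ne hT', hSx]
    obtain ⟨d, hd⟩ : ∃ d, d = f x • q + g x • q' := ⟨_, rfl⟩
    rw [← hd]
    have e1 := (T.isSymm_lapMatrix (R := ℝ)).dotProduct_mulVec_add_sub x d
    have e2 := (Matrix.isSymm_one (n := V) (α := ℝ)).dotProduct_mulVec_add_sub x d
    simp only [one_mulVec] at e2
    obtain ⟨z, hz⟩ : ∃ z, z = x + (x + d) := ⟨_, rfl⟩
    rw [← hz] at e1 e2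
    have hqdot : ∀ v : V → ℝ, q ⬝ᵥ v = v wv + m⁻¹ * ∑ i, (v (a i) - β * v (b i)) := by
      intro v
      simp [q, add_dotProduct, sum_dotProduct, sub_dotProduct, ← Finset.mul_sum]
    have hq'dot : ∀ v : V → ℝ, q' ⬝ᵥ v = v p1 - β * v p2 := by
      intro v
      simp [q', sub_dotProduct]
    have hm0 : m ≠ 0 := by linarith
    have hqL : q ⬝ᵥ T.lapMatrix ℝ *ᵥ z - (2 - ε) * (q ⬝ᵥ z) = δ * z wv - z u := by
      have hsum : ∑ i, ((T.lapMatrix ℝ *ᵥ z) (a i) - β * (T.lapMatrix ℝ *ᵥ z) (b i)) -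
          (2 - ε) * ∑ i, (z (a i) - β * z (b i)) = m * ∑ i, z (a i) - r * z wv := by
        have hconst : (r : ℝ) * z wv = ∑ _i : Fin r, z wv := by simp
        rw [hconst, Finset.mul_sum, Finset.mul_sum, ← Finset.sum_sub_distrib,
          ← Finset.sum_sub_distrib]
        refine Finset.sum_congr rfl fun i _ => ?_
        rw [La, Lb, hm]
        linear_combination z (b i) * hβ
      rw [hqdot, hqdot, Lw, hδdef]
      have hmm : m⁻¹ * m = 1 := inv_mul_cancel₀ hm0
      linear_combination m⁻¹ * hsum + (∑ i, z (a i)) * hmm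
    have hq'L : q' ⬝ᵥ T.lapMatrix ℝ *ᵥ z - (2 - ε) * (q' ⬝ᵥ z) = m * z p1 - z u := by
      rw [hq'dot, hq'dot, Lp1, Lp2, hm]
      linear_combination z p2 * hβ
    have hdu : d u = 0 := by simp [hd, hqu, hq'u]
    have hdw : d wv = k * x u := by simp [hd, hqw, hq'w, hf]
    have hdp : d p1 = m⁻¹ * (x wv + (k - 1) * x u) := by simp [hd, hqp, hq'p, hg]
    have hdL : d ⬝ᵥ T.lapMatrix ℝ *ᵥ z - (2 - ε) * (d ⬝ᵥ z) =
        f x * (δ * z wv - z u) + g x * (m * z p1 - z u) := by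
      rw [← hqL, ← hq'L, hd]
      simp only [add_dotProduct, smul_dotProduct, smul_eq_mul]
      ring
    have hpos := reduced_form_nonneg (x := x wv) (s := x u) hm1 hδ hδ' rfl hk
    have hfinal : f x * (δ * z wv - z u) + g x * (m * z p1 - z u)
        - ((x + d) u - (x + d) p1) ^ 2 + ((x + d) wv - (x + d) p1) ^ 2 =
        (1 - 1 / m) * ((x wv + k * x u) ^ 2 - x u ^ 2) +
          k * x u * (δ * (2 * x wv + k * x u) - 2 * x u) := by
      simp only [hz, Pi.add_apply, hdu, hdw, hdp, hf, hg]
      field_simp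
      ring
    linear_combination hpos - hfinal - e1 + (2 - ε) * e2 - hdL
end

section
/- (Star-star transform, case of two length-one branches, is proper.) Let T be a tree on n ≥ 8 vertices and let u be a vertex adjacent to two distinct vertices w_1 and w_2 such that for i = 1, 2 the vertex w_i has degree r_i + 1 in T and exactly r_i pendant P_2's are attached at w_i, where r_1, r_2 ≥ 0 and r_1 + r_2 ≤ ⌊n/4⌋. Let T′ be the tree on n vertices obtained from T by replacing these two branches at u by a single path u, a, w of length 2 (with a of degree 2) in which exactly r_1 + r_2 pendant P_2's are attached at w, leaving the rest of T unchanged. Then the number of Laplacian eigenvalues of T′ that are ≥ 2 − 2/n is at least the number of Laplacian eigenvalues of T that are ≥ 2 − 2/n. -/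
open Matrix in
/-- The span of the eigenvectors indexed by `p`, in coordinates diagonalising `x ↦ xᵀ (M - θ) x`. -/
theorem Matrix.IsHermitian.exists_injective_diagonalizing {V : Type*} [Fintype V] [DecidableEq V]
    {M : Matrix V V ℝ} (hM : M.IsHermitian) (θ : ℝ) (p : V → Prop) [DecidablePred p] :
    ∃ F : ({i // p i} → ℝ) →ₗ[ℝ] (V → ℝ), Function.Injective F ∧
      ∀ c, ∑ v, F c v * ((M *ᵥ F c) v - θ * F c v) =
        ∑ i : {i // p i}, (hM.eigenvalues i - θ) * c i ^ 2 := by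
  let b (i : {i // p i}) : V → ℝ := (hM.eigenvectorBasis i : V → ℝ)
  have orth (i j : {i // p i}) : b i ⬝ᵥ b j = if i = j then 1 else 0 := by
    have := orthonormal_iff_ite.mp hM.eigenvectorBasis.orthonormal i j
    simp only [EuclideanSpace.inner_eq_star_dotProduct, star_trivial, Subtype.coe_inj] at this
    rw [dotProduct_comm]
    exact this
  have eig (i : {i // p i}) : M *ᵥ b i = hM.eigenvalues i • b i := hM.mulVec_eigenvectorBasis i
  have coord (c d : {i // p i} → ℝ) :
      Fintype.linearCombination ℝ b c ⬝ᵥ Fintype.linearCombination ℝ b d = ∑ i, c i * d i := by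
    simp [Fintype.linearCombination_apply, sum_dotProduct, dotProduct_sum, orth, mul_comm]
  refine ⟨Fintype.linearCombination ℝ b, ?_, fun c => ?_⟩
  · rw [injective_iff_map_eq_zero]
    intro c hc
    have h := coord c c
    rw [hc, zero_dotProduct, eq_comm,
      Finset.sum_eq_zero_iff_of_nonneg fun i _ => mul_self_nonneg (c i)] at h
    ext i
    simpa using h i (Finset.mem_univ i)
  · have key : M *ᵥ Fintype.linearCombination ℝ b c - θ • Fintype.linearCombination ℝ b c =
        Fintype.linearCombination ℝ b fun i => (hM.eigenvalues i - θ) * c i := by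
      simp only [Fintype.linearCombination_apply, mulVec_sum, mulVec_smul, eig, Finset.smul_sum,
        ← Finset.sum_sub_distrib, smul_smul, ← sub_smul]
      congr! 2
      ring
    change Fintype.linearCombination ℝ b c ⬝ᵥ
      (M *ᵥ Fintype.linearCombination ℝ b c - θ • Fintype.linearCombination ℝ b c) = _
    rw [key, coord]
    congr! 1
    ring

open Matrix in
/-- Comparison of the numbers of eigenvalues `≥ θ` of two symmetric matrices: it suffices that
`|V|` linear conditions on a pair `(x, y)` exclude that `x ≠ 0` or `y ≠ 0` when the form of `M - θ`
is nonnegative at `x` and the form of `M' - θ` is negative at `y`. -/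
theorem Matrix.IsHermitian.card_le_eigenvalues_le {V W : Type*} [Fintype V] [DecidableEq V]
    [AddCommGroup W] [Module ℝ W] [FiniteDimensional ℝ W]
    {M M' : Matrix V V ℝ} (hM : M.IsHermitian) (hM' : M'.IsHermitian) (θ : ℝ)
    (hW : Module.finrank ℝ W ≤ Fintype.card V) (φ : (V → ℝ) × (V → ℝ) →ₗ[ℝ] W)
    (hφ : ∀ x y : V → ℝ, φ (x, y) = 0 → 0 ≤ ∑ v, x v * ((M *ᵥ x) v - θ * x v) →
      (y ≠ 0 → ∑ v, y v * ((M' *ᵥ y) v - θ * y v) < 0) → x = 0 ∧ y = 0) :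
    Nat.card {i // θ ≤ hM.eigenvalues i} ≤ Nat.card {i // θ ≤ hM'.eigenvalues i} := by
  classical
  obtain ⟨F, hF, hFq⟩ := hM.exists_injective_diagonalizing θ fun i => θ ≤ hM.eigenvalues i
  obtain ⟨F', hF', hFq'⟩ := hM'.exists_injective_diagonalizing θ fun i => ¬ θ ≤ hM'.eigenvalues i
  by_contra! hlt
  rw [Nat.card_eq_fintype_card, Nat.card_eq_fintype_card] at hlt
  have hsum := Fintype.card_subtype_compl fun i => θ ≤ hM'.eigenvalues i
  have hle := Fintype.card_subtype_le fun i => θ ≤ hM'.eigenvalues i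
  have hker : LinearMap.ker (φ ∘ₗ F.prodMap F') ≠ ⊥ := by
    apply LinearMap.ker_ne_bot_of_finrank_lt
    rw [Module.finrank_prod, Module.finrank_fintype_fun_eq_card,
      Module.finrank_fintype_fun_eq_card]
    omega
  obtain ⟨⟨c, d⟩, hcd, hne⟩ := (Submodule.ne_bot_iff _).mp hker
  obtain ⟨hx, hy⟩ := hφ (F c) (F' d) hcd
    (by
      rw [hFq]
      exact Finset.sum_nonneg fun i _ => mul_nonneg (sub_nonneg.mpr i.2) (sq_nonneg _))
    (by
      intro hy
      rw [hFq']
      have hd : d ≠ 0 := fun h => hy (by rw [h, map_zero])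
      obtain ⟨i, hi⟩ := Function.ne_iff.mp hd
      refine Finset.sum_neg' (fun j _ => ?_) ⟨i, Finset.mem_univ i, ?_⟩
      · exact mul_nonpos_of_nonpos_of_nonneg (sub_nonpos.mpr (not_le.mp j.2).le) (sq_nonneg _)
      · exact mul_neg_of_neg_of_pos (sub_neg.mpr (not_le.mp i.2)) (sq_pos_of_ne_zero hi))
  refine hne (Prod.ext (hF ?_) (hF' ?_))
  · simpa using hx
  · simpa using hy

namespace SimpleGraph

variable {V : Type*} [Fintype V] [DecidableEq V] {G : SimpleGraph V} [DecidableRel G.Adj]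

omit [DecidableEq V] in
theorem neighborFinset_eq_of_forall_adj {v : V} {s : Finset V} (hs : ∀ y ∈ s, G.Adj v y)
    (hd : G.degree v ≤ s.card) : G.neighborFinset v = s :=
  (Finset.eq_of_subset_of_card_le (fun y hy => (G.mem_neighborFinset v y).mpr (hs y hy)) hd).symm

theorem neighborFinset_eq_insert_image {r : ℕ} {u w : V} {a : Fin r → V}
    (ha : Function.Injective a) (hu : ∀ i, a i ≠ u) (huw : G.Adj u w) (hwa : ∀ i, G.Adj w (a i))
    (hd : G.degree w = r + 1) :
    G.neighborFinset w = insert u (Finset.univ.image a) := by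
  apply neighborFinset_eq_of_forall_adj
  · simpa using ⟨huw.symm, hwa⟩
  · rw [Finset.card_insert_of_notMem (by simpa using hu), Finset.card_image_of_injective _ ha]
    simp [hd]

theorem neighborFinset_eq_pair {v p q : V} (hpq : p ≠ q) (hp : G.Adj v p) (hq : G.Adj v q)
    (hd : G.degree v = 2) : G.neighborFinset v = {p, q} :=
  neighborFinset_eq_of_forall_adj (by simp [hp, hq]) (by rw [Finset.card_pair hpq, hd])

omit [DecidableEq V] in
theorem neighborFinset_eq_singleton {v p : V} (hp : G.Adj v p) (hd : G.degree v = 1) :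
    G.neighborFinset v = {p} :=
  neighborFinset_eq_of_forall_adj (by simp [hp]) (by rw [Finset.card_singleton, hd])

/-- On a vertex `w` with `r` pendant `P₂`'s `aᵢ, bᵢ`, attached to the rest of the graph at `u`, the
form of `L - (2 - ε)` is negative definite on the functions vanishing at `u` that are critical in
the coordinates `aᵢ`. -/
theorem pendant_form_neg {r : ℕ} {u w : V} {a b : Fin r → V} {x : V → ℝ} {ε c : ℝ}
    (hNw : G.neighborFinset w = insert u (Finset.univ.image a))
    (hNa : ∀ i, G.neighborFinset (a i) = {w, b i}) (hNb : ∀ i, G.neighborFinset (b i) = {a i})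
    (ha : Function.Injective a) (hu : ∀ i, a i ≠ u) (hwb : ∀ i, w ≠ b i)
    (hε : 0 < ε) (hε' : ε ≤ 1 / 4) (hr : r * ε ≤ 1 / 2)
    (hc : c = (1 - ε) / (1 + ε - ε ^ 2)) (hxu : x u = 0) (hxa : ∀ i, x (a i) = c * x w)
    (f : V → ℝ) (hf : ∀ v, f v = x v * ((G.lapMatrix ℝ).mulVec x v - (2 - ε) * x v)) :
    f w + ∑ i, f (a i) + ∑ i, f (b i) ≤ 0 ∧
      (0 ≤ f w + ∑ i, f (a i) + ∑ i, f (b i) → x w = 0 ∧ ∀ i, x (b i) = 0) := by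
  have hpos : 0 < 1 + ε - ε ^ 2 := by nlinarith
  obtain ⟨κ, hκ⟩ : ∃ κ, κ = 1 / (1 + ε - ε ^ 2) := ⟨_, rfl⟩
  have hκ1 : κ * (1 + ε - ε ^ 2) = 1 := by rw [hκ]; field_simp
  have hκ0 : 0 < κ := by rw [hκ]; positivity
  have hcκ : c = (1 - ε) * κ := by rw [hc, hκ]; ring
  have hfw : f w = x w * ((r + 1) * x w - r * (c * x w) - (2 - ε) * x w) := by
    have hdeg : G.degree w = r + 1 := by
      rw [← card_neighborFinset_eq_degree, hNw,
        Finset.card_insert_of_notMem (by simpa using hu), Finset.card_image_of_injective _ ha]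
      simp
    rw [hf, lapMatrix_mulVec_apply, hNw, Finset.sum_insert (by simpa using hu),
      Finset.sum_image ha.injOn, hdeg]
    simp [hxu, hxa]
  have hfa (i) : f (a i) = c * x w * (2 * (c * x w) - (x w + x (b i)) - (2 - ε) * (c * x w)) := by
    rw [hf, lapMatrix_mulVec_apply, ← card_neighborFinset_eq_degree, hNa,
      Finset.card_pair (hwb i), Finset.sum_pair (hwb i), hxa]
    norm_num
  have hfb (i) : f (b i) = x (b i) * (x (b i) - c * x w - (2 - ε) * x (b i)) := by
    rw [hf, lapMatrix_mulVec_apply, ← card_neighborFinset_eq_degree, hNb]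
    simp [hxa]
  have hsq (i) : f (a i) + f (b i) = -((1 - ε) * (x (b i) + κ * x w) ^ 2) := by
    rw [hfa, hfb, hcκ]
    linear_combination ((1 - ε) * κ * x w ^ 2) * hκ1
  have hS : f w + ∑ i, f (a i) + ∑ i, f (b i) =
      (r * (1 - c) - (1 - ε)) * x w ^ 2 - (1 - ε) * ∑ i, (x (b i) + κ * x w) ^ 2 := by
    rw [add_assoc, ← Finset.sum_add_distrib, Finset.sum_congr rfl fun i _ => hsq i,
      Finset.sum_neg_distrib, ← Finset.mul_sum, hfw]
    ring
  have hneg : r * (1 - c) - (1 - ε) < 0 := by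
    have h1 : 1 - c = κ * (2 - ε) * ε := by
      rw [hcκ]
      linear_combination -hκ1
    have h2 : r * (1 - c) ≤ κ * (2 - ε) * (1 / 2) := by
      rw [h1]
      have : 0 ≤ κ * (2 - ε) := by nlinarith
      nlinarith
    have h3 : κ * (2 - ε) * (1 / 2) < 1 - ε := by
      rw [hκ, div_mul_eq_mul_div, div_mul_eq_mul_div, div_lt_iff₀ hpos]
      nlinarith [mul_pos hε hε, mul_pos hε (mul_pos hε hε)]
    linarith
  have hsum : 0 ≤ ∑ i, (x (b i) + κ * x w) ^ 2 := Finset.sum_nonneg fun i _ => sq_nonneg _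
  have hw2 := sq_nonneg (x w)
  rw [hS]
  refine ⟨by nlinarith, fun h => ?_⟩
  have hxw : x w ^ 2 = 0 := by nlinarith
  have hsum0 : ∑ i, (x (b i) + κ * x w) ^ 2 = 0 := by nlinarith
  have hxw : x w = 0 := by simpa using hxw
  rw [Finset.sum_eq_zero_iff_of_nonneg fun i _ => sq_nonneg _] at hsum0
  exact ⟨hxw, fun i => by simpa [hxw] using hsum0 i (Finset.mem_univ i)⟩

end SimpleGraph

/-- **Star-star transform (two length-one branches) is proper.**  Let `T` be a
tree on `n ≥ 8` vertices and `u` a vertex adjacent to two distinct vertices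
`w1` and `w2`, where `wᵢ` has degree `rᵢ + 1` and carries exactly `rᵢ` pendant
`P₂`'s (middles `aᵢ j`, leaves `bᵢ j`), with `r1 + r2 ≤ ⌊n/4⌋`.  Let `T'` be
the tree obtained by replacing these two branches at `u` by a single path
`u, w2, w1` of length 2 in which exactly `r1 + r2` pendant `P₂`'s are attached
at `w1`: the edge `u — w1` is deleted, the edge `w1 — w2` is added, and each
edge `w2 — a2 i` is replaced by `w1 — a2 i`, everything else being unchanged.
Then the number of Laplacian eigenvalues `≥ 2 - 2/n` does not decrease from
`T` to `T'`. -/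
theorem starStar_proper {V : Type*} [Fintype V] [DecidableEq V]
    (T T' : SimpleGraph V) [DecidableRel T.Adj] [DecidableRel T'.Adj]
    (hn : 8 ≤ Fintype.card V) (hT : T.IsTree)
    (r1 r2 : ℕ) (hr : r1 + r2 ≤ Fintype.card V / 4)
    (u w1 w2 : V) (a1 b1 : Fin r1 → V) (a2 b2 : Fin r2 → V)
    (hinj : Function.Injective
      (Sum.elim ![u, w1, w2] (Sum.elim (Sum.elim a1 b1) (Sum.elim a2 b2))))
    (huw1 : T.Adj u w1) (huw2 : T.Adj u w2)
    (hdegw1 : T.degree w1 = r1 + 1) (hdegw2 : T.degree w2 = r2 + 1)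
    (hsun1 : ∀ i, T.Adj w1 (a1 i)) (hP21 : ∀ i, T.Adj (a1 i) (b1 i))
    (hdega1 : ∀ i, T.degree (a1 i) = 2) (hdegb1 : ∀ i, T.degree (b1 i) = 1)
    (hsun2 : ∀ i, T.Adj w2 (a2 i)) (hP22 : ∀ i, T.Adj (a2 i) (b2 i))
    (hdega2 : ∀ i, T.degree (a2 i) = 2) (hdegb2 : ∀ i, T.degree (b2 i) = 1)
    (hT' : ∀ x y, T'.Adj x y ↔
      (T.Adj x y ∧ ¬((x = u ∧ y = w1) ∨ (x = w1 ∧ y = u)) ∧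
        ∀ i, ¬((x = w2 ∧ y = a2 i) ∨ (x = a2 i ∧ y = w2))) ∨
      ((x = w1 ∧ y = w2) ∨ (x = w2 ∧ y = w1)) ∨
      (∃ i, (x = w1 ∧ y = a2 i) ∨ (x = a2 i ∧ y = w1))) :
    Nat.card {i // 2 - 2 / (Fintype.card V : ℝ) ≤ (lapHerm T).eigenvalues i} ≤
    Nat.card {i // 2 - 2 / (Fintype.card V : ℝ) ≤ (lapHerm T').eigenvalues i} := by
  have hcard : (8 : ℝ) ≤ Fintype.card V := by exact_mod_cast hn
  have hr4 : ((r1 : ℝ) + r2) * 4 ≤ Fintype.card V := by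
    exact_mod_cast (Nat.le_div_iff_mul_le (by norm_num)).mp hr
  obtain ⟨ε, hεdef⟩ : ∃ ε, ε = 2 / (Fintype.card V : ℝ) := ⟨_, rfl⟩
  have hε : 0 < ε := by rw [hεdef]; positivity
  have hε' : ε ≤ 1 / 4 := by
    rw [hεdef, div_le_iff₀ (by positivity)]
    linarith
  have hrε : ((r1 : ℝ) + r2) * ε ≤ 1 / 2 := by
    rw [hεdef, ← mul_div_assoc, div_le_iff₀ (by positivity)]
    linarith
  rw [← hεdef]
  obtain ⟨c, hc⟩ : ∃ c, c = (1 - ε) / (1 + ε - ε ^ 2) := ⟨_, rfl⟩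
  let e : Fin 3 ⊕ (Fin r1 ⊕ Fin r1) ⊕ (Fin r2 ⊕ Fin r2) → V :=
    Sum.elim ![u, w1, w2] (Sum.elim (Sum.elim a1 b1) (Sum.elim a2 b2))
  have he : Function.Injective e := hinj
  have ha1 : Function.Injective a1 := fun i j h => by
    simpa using @he (.inr (.inl (.inl i))) (.inr (.inl (.inl j))) h
  have ha2 : Function.Injective a2 := fun i j h => by
    simpa using @he (.inr (.inr (.inl i))) (.inr (.inr (.inl j))) h
  have hne {k l} (h : k ≠ l) : e k ≠ e l := he.ne h
  have hua1 (i) : a1 i ≠ u := @hne (.inr (.inl (.inl i))) (.inl 0) (by simp)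
  have hua2 (i) : a2 i ≠ u := @hne (.inr (.inr (.inl i))) (.inl 0) (by simp)
  have hwa1 (i) : w1 ≠ a1 i := @hne (.inl 1) (.inr (.inl (.inl i))) (by simp)
  have hw1a2 (i) : w1 ≠ a2 i := @hne (.inl 1) (.inr (.inr (.inl i))) (by simp)
  have hw1b1 (i) : w1 ≠ b1 i := @hne (.inl 1) (.inr (.inl (.inr i))) (by simp)
  have hw2b1 (i) : w2 ≠ b1 i := @hne (.inl 2) (.inr (.inl (.inr i))) (by simp)
  have hw1b2 (i) : w1 ≠ b2 i := @hne (.inl 1) (.inr (.inr (.inr i))) (by simp)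
  have hw2b2 (i) : w2 ≠ b2 i := @hne (.inl 2) (.inr (.inr (.inr i))) (by simp)
  have huw1' : u ≠ w1 := huw1.ne
  have hww : w1 ≠ w2 := @hne (.inl 1) (.inl 2) (by simp)
  have hNw1 := SimpleGraph.neighborFinset_eq_insert_image ha1 hua1 huw1 hsun1 hdegw1
  have hNw2 := SimpleGraph.neighborFinset_eq_insert_image ha2 hua2 huw2 hsun2 hdegw2
  have hNa1 (i) := SimpleGraph.neighborFinset_eq_pair (hw1b1 i) (hsun1 i).symm (hP21 i) (hdega1 i)
  have hNa2 (i) := SimpleGraph.neighborFinset_eq_pair (hw2b2 i) (hsun2 i).symm (hP22 i) (hdega2 i)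
  have hNb1 (i) := SimpleGraph.neighborFinset_eq_singleton (hP21 i).symm (hdegb1 i)
  have hNb2 (i) := SimpleGraph.neighborFinset_eq_singleton (hP22 i).symm (hdegb2 i)
  have adj_w2 (y) : T.Adj w2 y ↔ y = u ∨ ∃ i, y = a2 i := by
    rw [← T.mem_neighborFinset, hNw2]
    simp [eq_comm]
  have adj_a1 (i y) : T.Adj (a1 i) y ↔ y = w1 ∨ y = b1 i := by
    rw [← T.mem_neighborFinset, hNa1]
    simp
  have adj_a2 (i y) : T.Adj (a2 i) y ↔ y = w2 ∨ y = b2 i := by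
    rw [← T.mem_neighborFinset, hNa2]
    simp
  have hNw2' : T'.neighborFinset w2 = {u, w1} := by
    ext y
    simp only [SimpleGraph.mem_neighborFinset, hT', adj_w2, Finset.mem_insert,
      Finset.mem_singleton]
    grind
  have hNa1' (i) : T'.neighborFinset (a1 i) = {w1, b1 i} := by
    ext y
    simp only [SimpleGraph.mem_neighborFinset, hT', adj_a1, Finset.mem_insert,
      Finset.mem_singleton]
    grind
  have hNa2' (i) : T'.neighborFinset (a2 i) = {w1, b2 i} := by
    ext y
    simp only [SimpleGraph.mem_neighborFinset, hT', adj_a2, Finset.mem_insert,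
      Finset.mem_singleton]
    grind
  have mem_u : u ∈ Set.range e := ⟨.inl 0, rfl⟩
  have mem_w1 : w1 ∈ Set.range e := ⟨.inl 1, rfl⟩
  have mem_w2 : w2 ∈ Set.range e := ⟨.inl 2, rfl⟩
  have mem_a1 (i) : a1 i ∈ Set.range e := ⟨.inr (.inl (.inl i)), rfl⟩
  have mem_b1 (i) : b1 i ∈ Set.range e := ⟨.inr (.inl (.inr i)), rfl⟩
  have mem_a2 (i) : a2 i ∈ Set.range e := ⟨.inr (.inr (.inl i)), rfl⟩
  have mem_b2 (i) : b2 i ∈ Set.range e := ⟨.inr (.inr (.inr i)), rfl⟩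
  have hN' {v} (hv : v ∉ Set.range e) : T'.neighborFinset v = T.neighborFinset v := by
    ext y
    simp only [SimpleGraph.mem_neighborFinset, hT']
    grind
  have closed {v y} (hv : v ∉ Set.range e) (hvy : T.Adj v y) : y = u ∨ y ∉ Set.range e := by
    by_contra! h
    obtain ⟨hyu, k, rfl⟩ := h
    have hmem := (T.mem_neighborFinset _ _).mpr hvy.symm
    rcases k with k | (i | i) | (i | i)
    · fin_cases k
      · exact hyu rfl
      · change v ∈ T.neighborFinset w1 at hmem
        rw [hNw1] at hmem
        grind
      · change v ∈ T.neighborFinset w2 at hmem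
        rw [hNw2] at hmem
        grind
    · change v ∈ T.neighborFinset (a1 i) at hmem
      rw [hNa1] at hmem
      grind
    · change v ∈ T.neighborFinset (b1 i) at hmem
      rw [hNb1] at hmem
      grind
    · change v ∈ T.neighborFinset (a2 i) at hmem
      rw [hNa2] at hmem
      grind
    · change v ∈ T.neighborFinset (b2 i) at hmem
      rw [hNb2] at hmem
      grind
  let φ : (V → ℝ) × (V → ℝ) →ₗ[ℝ]
      (Fin 3 ⊕ (Fin r1 ⊕ Fin r1) ⊕ (Fin r2 ⊕ Fin r2) → ℝ) × ({v // v ∉ Set.range e} → ℝ) :=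
    { toFun := fun p =>
        (Sum.elim ![p.1 u, p.2 u, p.2 w1]
          (Sum.elim (Sum.elim (fun i => p.1 (a1 i) - c * p.1 w1) fun i => p.2 (b1 i))
            (Sum.elim (fun i => p.1 (a2 i) - c * p.1 w2) fun i => p.2 (b2 i))),
          fun v => p.1 v - p.2 v)
      map_add' := fun p q => by
        refine Prod.ext (funext fun k => ?_) (funext fun v => ?_)
        · rcases k with k | (i | i) | (i | i)
          · fin_cases k <;> rfl
          all_goals simp
          all_goals ring
        · simp
          ring
      map_smul' := fun s p => by
        refine Prod.ext (funext fun k => ?_) (funext fun v => ?_)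
        · rcases k with k | (i | i) | (i | i)
          · fin_cases k <;> rfl
          all_goals simp
          all_goals ring
        · simp
          ring }
  refine (lapHerm T).card_le_eigenvalues_le (lapHerm T') (2 - ε) ?_ φ ?_
  · have h1 := Set.card_range_of_injective he
    have h2 := Fintype.card_subtype_compl fun v => v ∈ Set.range e
    have h3 := Fintype.card_subtype_le fun v => v ∈ Set.range e
    have h4 := Fintype.card_le_of_injective e he
    rw [Module.finrank_prod, Module.finrank_fintype_fun_eq_card,
      Module.finrank_fintype_fun_eq_card]
    have h5 : Fintype.card {v // v ∈ Set.range e} = _ := h1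
    omega
  intro x y hxy hQx hQy
  have h1 := congr_fun (congr_arg Prod.fst hxy)
  have h2 := congr_fun (congr_arg Prod.snd hxy)
  have hxu : x u = 0 := h1 (.inl 0)
  have hyu : y u = 0 := h1 (.inl 1)
  have hyw1 : y w1 = 0 := h1 (.inl 2)
  have hxa1 (i) : x (a1 i) = c * x w1 := sub_eq_zero.mp (h1 (.inr (.inl (.inl i))))
  have hyb1 (i) : y (b1 i) = 0 := h1 (.inr (.inl (.inr i)))
  have hxa2 (i) : x (a2 i) = c * x w2 := sub_eq_zero.mp (h1 (.inr (.inr (.inl i))))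
  have hyb2 (i) : y (b2 i) = 0 := h1 (.inr (.inr (.inr i)))
  have hxy {v} (hv : v ∉ Set.range e) : x v = y v := sub_eq_zero.mp (h2 ⟨v, hv⟩)
  obtain ⟨f, hf⟩ : ∃ f : V → ℝ, ∀ v, f v = x v * ((T.lapMatrix ℝ).mulVec x v - (2 - ε) * x v) :=
    ⟨_, fun _ => rfl⟩
  obtain ⟨g, hg⟩ : ∃ g : V → ℝ, ∀ v, g v = y v * ((T'.lapMatrix ℝ).mulVec y v - (2 - ε) * y v) :=
    ⟨_, fun _ => rfl⟩
  simp only [← hf] at hQx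
  simp only [← hg] at hQy
  have hr1 : (0 : ℝ) ≤ r1 := r1.cast_nonneg
  have hr2 : (0 : ℝ) ≤ r2 := r2.cast_nonneg
  obtain ⟨hS1, hS1'⟩ := SimpleGraph.pendant_form_neg hNw1 hNa1 hNb1 ha1 hua1 hw1b1 hε hε'
    (by nlinarith) hc hxu hxa1 f hf
  obtain ⟨hS2, hS2'⟩ := SimpleGraph.pendant_form_neg hNw2 hNa2 hNb2 ha2 hua2 hw2b2 hε hε'
    (by nlinarith) hc hxu hxa2 f hf
  have hfg (v) (hv : v ∉ Set.range e) : f v - g v = 0 := by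
    have hsum : ∑ z ∈ T.neighborFinset v, x z = ∑ z ∈ T.neighborFinset v, y z := by
      refine Finset.sum_congr rfl fun z hz => ?_
      rcases closed hv ((T.mem_neighborFinset _ _).mp hz) with rfl | hz
      · rw [hxu, hyu]
      · exact hxy hz
    rw [hf, hg, SimpleGraph.lapMatrix_mulVec_apply, SimpleGraph.lapMatrix_mulVec_apply,
      ← T'.card_neighborFinset_eq_degree, hN' hv, T.card_neighborFinset_eq_degree, hxy hv, hsum,
      sub_self]
  have hdiff := Fintype.sum_of_injective e he (fun k => f (e k) - g (e k)) (fun v => f v - g v)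
    hfg fun _ => rfl
  have hgpair {v p q} (hpq : p ≠ q) (hN : T'.neighborFinset v = {p, q}) (hp : y p = 0)
      (hq : y q = 0) : 0 ≤ g v := by
    rw [hg, SimpleGraph.lapMatrix_mulVec_apply, ← T'.card_neighborFinset_eq_degree, hN,
      Finset.card_pair hpq, Finset.sum_pair hpq, hp, hq]
    push_cast
    nlinarith [mul_nonneg hε.le (sq_nonneg (y v))]
  have hg0 {v} (hv : y v = 0) : g v = 0 := by rw [hg, hv, zero_mul]
  have hge : 0 ≤ ∑ k, g (e k) := by
    refine Finset.sum_nonneg fun k _ => ?_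
    rcases k with k | (i | i) | (i | i)
    · fin_cases k
      · exact (hg0 hyu).ge
      · exact (hg0 hyw1).ge
      · exact hgpair huw1' hNw2' hyu hyw1
    · exact hgpair (hw1b1 i) (hNa1' i) hyw1 (hyb1 i)
    · exact (hg0 (hyb1 i)).ge
    · exact hgpair (hw1b2 i) (hNa2' i) hyw1 (hyb2 i)
    · exact (hg0 (hyb2 i)).ge
  have hfe : ∑ k, f (e k) = (f w1 + ∑ i, f (a1 i) + ∑ i, f (b1 i)) +
      (f w2 + ∑ i, f (a2 i) + ∑ i, f (b2 i)) := by
    have hfu : f u = 0 := by rw [hf, hxu, zero_mul]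
    simp only [e, Fintype.sum_sum_type, Fin.sum_univ_three, Sum.elim_inl, Sum.elim_inr,
      Matrix.cons_val, hfu]
    ring
  rw [Finset.sum_sub_distrib, Finset.sum_sub_distrib, hfe] at hdiff
  have hy : y = 0 := by
    by_contra hy
    linarith [hQy hy]
  subst hy
  have hgz (v) : g v = 0 := hg0 rfl
  simp only [hgz, Finset.sum_const_zero, sub_zero] at hdiff
  obtain ⟨hxw1, hxb1⟩ := hS1' (by linarith)
  obtain ⟨hxw2, hxb2⟩ := hS2' (by linarith)
  refine ⟨funext fun v => ?_, rfl⟩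
  by_cases hv : v ∈ Set.range e
  · obtain ⟨k, rfl⟩ := hv
    rcases k with k | (i | i) | (i | i)
    · fin_cases k
      · exact hxu
      · exact hxw1
      · exact hxw2
    · exact (hxa1 i).trans (by simp [hxw1])
    · exact hxb1 i
    · exact (hxa2 i).trans (by simp [hxw2])
    · exact hxb2 i
  · exact hxy hv
end
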